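/- For every integer n ≥ 7, H(n,7) ≥ (3/2)n − 9. -/

import Mathlib

open Filter Polynomial

/-- `Γ` is a periodic orbit of the planar vector field `V`: the image of a
nonconstant periodic solution of `γ' = V ∘ γ`. -/
def IsPeriodicOrbit (V : ℝ × ℝ → ℝ × ℝ) (Γ : Set (ℝ × ℝ)) : Prop :=
  ∃ γ : ℝ → ℝ × ℝ,
    (∀ t : ℝ, HasDerivAt γ (V (γ t)) t) ∧
    (∃ T : ℝ, 0 < T ∧ Function.Periodic γ T) ∧
    (∃ t₁ t₂ : ℝ, γ t₁ ≠ γ t₂) ∧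
    Γ = Set.range γ

/-- `Γ` is a limit cycle of `V`: a periodic orbit which is isolated among
periodic orbits. -/
def IsLimitCycle (V : ℝ × ℝ → ℝ × ℝ) (Γ : Set (ℝ × ℝ)) : Prop :=
  IsPeriodicOrbit V Γ ∧
  ∃ U : Set (ℝ × ℝ), IsOpen U ∧ Γ ⊆ U ∧
    ∀ Γ' : Set (ℝ × ℝ), IsPeriodicOrbit V Γ' → Γ' ⊆ U → Γ' = Γ

/-- The Liénard vector field `ẋ = y, ẏ = -g(x) - ε f(x) y`. -/
def lienard (f g : Polynomial ℝ) (ε : ℝ) : ℝ × ℝ → ℝ × ℝ :=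
  fun p => (p.2, -(g.eval p.1) - ε * (f.eval p.1) * p.2)

/-- `HGe n m c` formalizes `H(n,m) ≥ c`: there are polynomials `f, g` with
`deg f ≤ n`, `deg g ≤ m` and `ε₀ > 0` such that for every `0 < ε ≤ ε₀` the
Liénard system has at least `c` pairwise distinct limit cycles. -/
def HGe (n m : ℕ) (c : ℝ) : Prop :=
  ∃ f g : Polynomial ℝ, f.natDegree ≤ n ∧ g.natDegree ≤ m ∧
    ∃ ε₀ : ℝ, 0 < ε₀ ∧ ∀ ε : ℝ, 0 < ε → ε ≤ ε₀ →
      ∃ S : Finset (Set (ℝ × ℝ)),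
        (∀ Γ ∈ S, IsLimitCycle (lienard f g ε) Γ) ∧ c ≤ (S.card : ℝ)

open Set Topology Real

/-- A solution on `[0, T]` of a `T`-periodic scalar equation with equal end values extends to a
global periodic solution. -/
theorem exists_periodic_extension {F : ℝ → ℝ → ℝ} {α : ℝ → ℝ} {T : ℝ} (hT : 0 < T)
    (hα : ∀ t ∈ Icc 0 T, HasDerivWithinAt α (F t (α t)) (Icc 0 T) t) (h0 : α 0 = α T)
    (hper : ∀ t x, F (t + T) x = F t x) {s : Set ℝ} (hs : ∀ t ∈ Icc 0 T, α t ∈ s)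
    (hF : ∀ t, ∀ x ∈ s, ContinuousAt (fun p : ℝ × ℝ => F p.1 p.2) (t, x)) :
    ∃ β : ℝ → ℝ, Function.Periodic β T ∧ (∀ t, β t ∈ s) ∧
      ∀ t, HasDerivAt β (F t (β t)) t := by
  have : Fact (0 < T) := ⟨hT⟩
  have hcα : ContinuousOn α (Icc 0 T) := fun t ht => (hα t ht).continuousWithinAt
  set β : ℝ → ℝ := fun t => AddCircle.liftIco T 0 α (t : AddCircle T) with hβ
  have hβc : Continuous β :=
    (AddCircle.liftIco_zero_continuous h0 hcα).comp (AddCircle.continuous_mk' T)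
  have hβp : Function.Periodic β T := fun t => by simp [hβ]
  have hβα : ∀ t ∈ Ico 0 T, β t = α t := fun t ht => AddCircle.liftIco_zero_coe_apply ht
  have hβα' : ∀ t ∈ Icc 0 T, β t = α t := by
    intro t ht
    rcases eq_or_lt_of_le ht.2 with h | h
    · rw [h, ← h0, ← hβα 0 ⟨le_rfl, hT⟩]
      simpa using hβp 0
    · exact hβα t ⟨ht.1, h⟩
  have hβs : ∀ t, β t ∈ s := by
    intro t
    obtain ⟨y, hy, hyt⟩ := hβp.exists_mem_Ico₀ hT t
    rw [hyt, hβα y hy]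
    exact hs y (Ico_subset_Icc_self hy)
  have hFc : Continuous fun t => F t (β t) := by
    rw [continuous_iff_continuousAt]
    intro t
    exact ContinuousAt.comp (f := fun t => (t, β t)) (g := fun p : ℝ × ℝ => F p.1 p.2)
      (hF t _ (hβs t)) (continuous_id.prodMk hβc).continuousAt
  have hFper : Function.Periodic (fun t => F t (β t)) T := fun t => by
    simp only [hβp t, hper]
  set w : ℝ → ℝ := fun t => β 0 + ∫ u in (0 : ℝ)..t, F u (β u) with hw
  have hwd : ∀ t, HasDerivAt w (F t (β t)) t := fun t =>
    ((hFc.integral_hasStrictDerivAt 0 t).hasDerivAt).const_add _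
  have hwβ : ∀ t ∈ Icc 0 T, w t = β t := by
    intro t ht
    have : ∫ u in (0 : ℝ)..t, F u (β u) = α t - α 0 := by
      refine intervalIntegral.integral_eq_sub_of_hasDerivAt_of_le ht.1
        (hcα.mono (Icc_subset_Icc_right ht.2)) (fun u hu => ?_) (hFc.intervalIntegrable _ _)
      have huT : u ∈ Ioo 0 T := ⟨hu.1, hu.2.trans_le ht.2⟩
      rw [hβα' u (Ioo_subset_Icc_self huT)]
      exact (hα u (Ioo_subset_Icc_self huT)).hasDerivAt (Icc_mem_nhds huT.1 huT.2)
    simp only [hw, this, hβα' t ht, hβα' 0 ⟨le_rfl, hT.le⟩]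
    ring
  have hint : ∫ u in (0 : ℝ)..T, F u (β u) = 0 := by
    have := hwβ T ⟨hT.le, le_rfl⟩
    have h2 : β T = β 0 := by simpa using hβp 0
    simp only [hw] at this
    linarith
  have hwp : Function.Periodic w T := by
    intro t
    have h1 := hFper.intervalIntegral_add_eq 0 t
    have h2 := intervalIntegral.integral_add_adjacent_intervals
      (hFc.intervalIntegrable 0 t (μ := MeasureTheory.volume)) (hFc.intervalIntegrable t (t + T))
    rw [zero_add, hint] at h1
    simp only [hw, ← h2, ← h1, add_zero]
  have hwe : w = β := by
    funext t
    obtain ⟨n, hn, -⟩ := existsUnique_add_zsmul_mem_Ico hT t 0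
    have h1 := hwβ _ ⟨hn.1, by simpa using hn.2.le⟩
    have h2 := hwp.zsmul n t
    have h3 := hβp.zsmul n t
    rw [← h2, ← h3, h1]
  refine ⟨β, hβp, hβs, fun t => ?_⟩
  have := hwd t
  rwa [hwe] at this

/-- Uniformity in the periodic variable: a property holding near each `(p, θ)` and periodic in `θ`
holds for all `θ` on a common neighbourhood of `p`. -/
theorem eventually_forall_of_periodic {E : Type*} [TopologicalSpace E] {P : E → ℝ → Prop} {T : ℝ}
    (hT : 0 < T) (hper : ∀ p θ, P p (θ + T) ↔ P p θ) {p₀ : E}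
    (h : ∀ θ, ∀ᶠ z : E × ℝ in 𝓝 (p₀, θ), P z.1 z.2) : ∀ᶠ p in 𝓝 p₀, ∀ θ, P p θ := by
  filter_upwards [(isCompact_Icc (a := (0 : ℝ)) (b := T)).eventually_forall_of_forall_eventually
    (fun θ _ => h θ)] with p hp θ
  have hpp : Function.Periodic (P p) T := fun θ => propext (hper p θ)
  obtain ⟨y, hy, hyt⟩ := hpp.exists_mem_Ico₀ hT θ
  rw [hyt]
  exact hp y (Ico_subset_Icc_self hy)

/-- Partial derivative in the first variable. -/
noncomputable def partialFst (R : (ℝ × ℝ) × ℝ → ℝ) (z : (ℝ × ℝ) × ℝ) : ℝ :=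
  fderiv ℝ R z ((1, 0), 0)

theorem hasDerivAt_partialFst {R : (ℝ × ℝ) × ℝ → ℝ} {h ε θ : ℝ}
    (hR : DifferentiableAt ℝ R ((h, ε), θ)) :
    HasDerivAt (fun x => R ((x, ε), θ)) (partialFst R ((h, ε), θ)) h := by
  have h1 : HasDerivAt (fun x : ℝ => ((x, ε), θ)) (((1 : ℝ), (0 : ℝ)), (0 : ℝ)) h :=
    ((hasDerivAt_id h).prodMk (hasDerivAt_const h ε)).prodMk (hasDerivAt_const h θ)
  exact HasFDerivAt.comp_hasDerivAt (f := fun x : ℝ => ((x, ε), θ)) h hR.hasFDerivAt h1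

theorem continuousAt_partialFst {R : (ℝ × ℝ) × ℝ → ℝ} {z : (ℝ × ℝ) × ℝ}
    (hR : ContDiffAt ℝ 1 R z) : ContinuousAt (partialFst R) z := by
  have : ContinuousAt (fderiv ℝ R) z := (hR.fderiv_right (m := 0) (by norm_num)).continuousAt
  exact this.clm_apply continuousAt_const

theorem partialFst_periodic {R : (ℝ × ℝ) × ℝ → ℝ} {T : ℝ}
    (hper : ∀ p θ, R (p, θ + T) = R (p, θ)) (p : ℝ × ℝ) (θ : ℝ) :
    partialFst R (p, θ + T) = partialFst R (p, θ) := by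
  have : (fun z => R (z + (0, T))) = R := by
    funext ⟨p, θ⟩
    simpa using hper p θ
  unfold partialFst
  have h2 := fderiv_comp_add_right (𝕜 := ℝ) (f := R) (x := (p, θ)) ((0 : ℝ × ℝ), T)
  rw [this] at h2
  rw [h2]
  simp

/-- Uniform linear approximation near the circle `{(h₀, 0)} × ℝ`. -/
theorem exists_uniform_linear_approx {R : (ℝ × ℝ) × ℝ → ℝ} {T h₀ : ℝ} (hT : 0 < T)
    (hR : ∀ θ, ContDiffAt ℝ 1 R ((h₀, 0), θ)) (hper : ∀ p θ, R (p, θ + T) = R (p, θ))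
    {δ : ℝ} (hδ : 0 < δ) :
    ∃ η > 0, ∀ ε : ℝ, |ε| ≤ η →
      (∀ h θ, |h - h₀| ≤ η → ContinuousAt R ((h, ε), θ)) ∧
      ∀ h₁ h₂ θ, |h₁ - h₀| ≤ η → |h₂ - h₀| ≤ η →
        |R ((h₁, ε), θ) - R ((h₂, ε), θ) - partialFst R ((h₀, 0), θ) * (h₁ - h₂)|
          ≤ δ * |h₁ - h₂| := by
  have hc0 : Continuous fun θ => partialFst R ((h₀, 0), θ) := by
    rw [continuous_iff_continuousAt]
    intro θ
    exact (continuousAt_partialFst (hR θ)).comp (f := fun θ => ((h₀, (0 : ℝ)), θ))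
      (by fun_prop)
  have key : ∀ᶠ p : ℝ × ℝ in 𝓝 (h₀, 0), ∀ θ, ContDiffAt ℝ 1 R (p, θ) ∧
      |partialFst R (p, θ) - partialFst R ((h₀, 0), θ)| < δ := by
    refine eventually_forall_of_periodic hT (fun p θ => ?_) (fun θ => ?_)
    · rw [partialFst_periodic hper, partialFst_periodic hper]
      have : (fun z => R (z + (0, T))) = R := by
        funext ⟨p, θ⟩
        simpa using hper p θ
      refine and_congr_left fun _ => ⟨fun h => ?_, fun h => ?_⟩
      · rw [← this]
        have h' : ContDiffAt ℝ 1 R ((p, θ) + (0, T)) := by simpa using h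
        exact h'.comp (p, θ) (by fun_prop)
      · have h1 : R = fun z => R (z + (0, -T)) := by
          funext ⟨p, θ⟩
          simpa using hper p (θ + -T)
        rw [h1]
        have h' : ContDiffAt ℝ 1 R ((p, θ + T) + (0, -T)) := by simpa using h
        exact h'.comp (p, θ + T) (by fun_prop)
    · have h1 := (hR θ).eventually (by simp)
      have h2 : ContinuousAt (fun z : (ℝ × ℝ) × ℝ =>
          |partialFst R z - partialFst R ((h₀, 0), z.2)|) ((h₀, 0), θ) :=
        ((continuousAt_partialFst (hR θ)).sub (hc0.continuousAt.comp continuousAt_snd)).abs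
      have h3 := h2.eventually_lt (continuousAt_const (y := δ)) (by simpa using hδ)
      filter_upwards [h1, h3] with z hz1 hz2
      exact ⟨hz1, hz2⟩
  obtain ⟨η, hη, hball⟩ := Metric.eventually_nhds_iff_ball.1 key
  refine ⟨η / 2, by positivity, fun ε hε => ?_⟩
  have hmem : ∀ h, |h - h₀| ≤ η / 2 → (h, ε) ∈ Metric.ball (h₀, (0 : ℝ)) η := by
    intro h hh
    rw [Metric.mem_ball, Prod.dist_eq, max_lt_iff, Real.dist_eq, Real.dist_eq, sub_zero]
    constructor <;> dsimp only <;> linarith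
  refine ⟨fun h θ hh => (hball _ (hmem h hh) θ).1.continuousAt, fun h₁ h₂ θ hh₁ hh₂ => ?_⟩
  have hconv : Convex ℝ (Metric.closedBall h₀ (η / 2)) := convex_closedBall _ _
  have := hconv.norm_image_sub_le_of_norm_hasDerivWithin_le (C := δ)
    (f := fun x => R ((x, ε), θ) - partialFst R ((h₀, 0), θ) * x)
    (f' := fun x => partialFst R ((x, ε), θ) - partialFst R ((h₀, 0), θ))
    (fun x hx => ?_) (fun x hx => ?_) (x := h₂) (y := h₁)
    (by simpa [Real.dist_eq] using hh₂) (by simpa [Real.dist_eq] using hh₁)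
  · rw [Real.norm_eq_abs, Real.norm_eq_abs] at this
    convert this using 2
    ring
  · have hx' : |x - h₀| ≤ η / 2 := by simpa [Real.dist_eq] using hx
    have h1 := hasDerivAt_partialFst ((hball _ (hmem x hx') θ).1.differentiableAt (by simp))
    have h2 := (hasDerivAt_id x).const_mul (partialFst R ((h₀, 0), θ))
    rw [mul_one] at h2
    exact (h1.sub h2).hasDerivWithinAt
  · have hx' : |x - h₀| ≤ η / 2 := by simpa [Real.dist_eq] using hx
    exact (hball _ (hmem x hx') θ).2.le

theorem continuous_slice {R : (ℝ × ℝ) × ℝ → ℝ} {h ε : ℝ}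
    (hR : ∀ θ, ContinuousAt R ((h, ε), θ)) : Continuous fun θ => R ((h, ε), θ) :=
  continuous_iff_continuousAt.2 fun θ =>
    (hR θ).comp (f := fun θ => ((h, ε), θ)) (by fun_prop)

theorem continuous_partialFst_slice {R : (ℝ × ℝ) × ℝ → ℝ} {p : ℝ × ℝ}
    (hR : ∀ θ, ContDiffAt ℝ 1 R (p, θ)) : Continuous fun θ => partialFst R (p, θ) :=
  continuous_iff_continuousAt.2 fun θ =>
    (continuousAt_partialFst (hR θ)).comp (f := fun θ => (p, θ)) (by fun_prop)

/-- Differentiation of the averaged function. -/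
theorem hasDerivAt_average {R : (ℝ × ℝ) × ℝ → ℝ} {T h₀ : ℝ} (hT : 0 < T)
    (hR : ∀ θ, ContDiffAt ℝ 1 R ((h₀, 0), θ)) (hper : ∀ p θ, R (p, θ + T) = R (p, θ)) :
    HasDerivAt (fun h => ∫ θ in (0 : ℝ)..T, R ((h, 0), θ))
      (∫ θ in (0 : ℝ)..T, partialFst R ((h₀, 0), θ)) h₀ := by
  rw [hasDerivAt_iff_isLittleO, Asymptotics.isLittleO_iff]
  intro c hc
  obtain ⟨η, hη, H⟩ := exists_uniform_linear_approx hT hR hper (δ := c / T) (by positivity)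
  filter_upwards [Metric.closedBall_mem_nhds h₀ hη] with h hh
  rw [Metric.mem_closedBall, Real.dist_eq] at hh
  obtain ⟨H1, H2⟩ := H 0 (by simpa using hη.le)
  have hi : ∀ h, |h - h₀| ≤ η →
      IntervalIntegrable (fun θ => R ((h, 0), θ)) MeasureTheory.volume 0 T := fun h hh =>
    (continuous_slice fun θ => H1 h θ hh).intervalIntegrable _ _
  have h00 : |h₀ - h₀| ≤ η := by simpa using hη.le
  have hp := (continuous_partialFst_slice hR).intervalIntegrable (μ := MeasureTheory.volume) 0 T
  rw [smul_eq_mul, mul_comm, ← intervalIntegral.integral_mul_const,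
    ← intervalIntegral.integral_sub (hi h hh) (hi h₀ h00),
    ← intervalIntegral.integral_sub ((hi h hh).sub (hi h₀ h00)) (hp.mul_const _)]
  have := intervalIntegral.norm_integral_le_of_norm_le_const (a := 0) (b := T)
    (C := c / T * |h - h₀|)
    (f := fun θ => R ((h, 0), θ) - R ((h₀, 0), θ) - partialFst R ((h₀, 0), θ) * (h - h₀))
    fun θ _ => H2 h h₀ θ hh h00
  refine this.trans (le_of_eq ?_)
  rw [sub_zero, abs_of_pos hT, Real.norm_eq_abs]
  field_simp

theorem exists_bound_of_periodic {f : ℝ → ℝ} {T : ℝ} (hT : 0 < T) (hf : Continuous f)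
    (hper : Function.Periodic f T) : ∃ C > 0, ∀ x, |f x| ≤ C := by
  obtain ⟨C, hC⟩ := isCompact_Icc.exists_bound_of_continuousOn (s := Icc 0 T) hf.continuousOn
  refine ⟨max C 1, by positivity, fun x => ?_⟩
  obtain ⟨y, hy, hyx⟩ := hper.exists_mem_Ico₀ hT x
  rw [hyx]
  exact (hC y (Ico_subset_Icc_self hy)).trans (le_max_left _ _)

set_option maxHeartbeats 1000000 in
/-- Existence part of the averaging theorem for periodic scalar equations. -/
theorem exists_periodic_solution_of_simple_zero {R : (ℝ × ℝ) × ℝ → ℝ} {T h₀ m : ℝ} (hT : 0 < T)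
    (hR : ∀ θ, ContDiffAt ℝ 1 R ((h₀, 0), θ)) (hper : ∀ p θ, R (p, θ + T) = R (p, θ))
    (h0 : ∫ θ in (0 : ℝ)..T, R ((h₀, 0), θ) = 0)
    (hm : m = ∫ θ in (0 : ℝ)..T, partialFst R ((h₀, 0), θ)) (hm0 : m ≠ 0) :
    ∃ δ, T * δ < |m| ∧ ∀ η > 0, ∃ η' > 0, η' ≤ η ∧ ∃ ε₀ > 0, ∀ ε, 0 < ε → ε ≤ ε₀ →
      (∃ β : ℝ → ℝ, Function.Periodic β T ∧ (∀ θ, |β θ - h₀| < η') ∧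
        ∀ θ, HasDerivAt β (ε * R ((β θ, ε), θ)) θ) ∧
      ∀ h₁ h₂ θ, |h₁ - h₀| ≤ η' → |h₂ - h₀| ≤ η' →
        |R ((h₁, ε), θ) - R ((h₂, ε), θ) - partialFst R ((h₀, 0), θ) * (h₁ - h₂)|
          ≤ δ * |h₁ - h₂| := by
  have hmp : 0 < |m| := abs_pos.2 hm0
  set δ := |m| / (8 * T) with hδdef
  have hδ : 0 < δ := by positivity
  have hTδ : T * δ = |m| / 8 := by rw [hδdef]; field_simp
  refine ⟨δ, by rw [hTδ]; linarith, fun η hη => ?_⟩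
  obtain ⟨η₁, hη₁, H⟩ := exists_uniform_linear_approx hT hR hper hδ
  set η' := min η η₁ with hη'
  have hη'0 : 0 < η' := lt_min hη hη₁
  have hη'1 : η' ≤ η₁ := min_le_right _ _
  refine ⟨η', hη'0, min_le_left _ _, ?_⟩
  set r₀ : ℝ → ℝ := fun θ => partialFst R ((h₀, 0), θ) with hr₀
  have hr₀c : Continuous r₀ := continuous_partialFst_slice hR
  have hRc : Continuous fun θ => R ((h₀, 0), θ) := continuous_slice fun θ => (hR θ).continuousAt
  obtain ⟨C, hC, hCr⟩ := exists_bound_of_periodic hT hr₀c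
    (fun θ => partialFst_periodic hper _ _)
  obtain ⟨C', hC', hCR⟩ := exists_bound_of_periodic hT hRc (fun θ => hper _ _)
  have key : ∀ᶠ p : ℝ × ℝ in 𝓝 (h₀, 0), ∀ θ, |R (p, θ) - R ((h₀, 0), θ)| < δ * η' := by
    refine eventually_forall_of_periodic hT (fun p θ => by rw [hper, hper]) (fun θ => ?_)
    have h2 : ContinuousAt (fun z : (ℝ × ℝ) × ℝ =>
        |R z - R ((h₀, 0), z.2)|) ((h₀, 0), θ) :=
      ((hR θ).continuousAt.sub (hRc.continuousAt.comp continuousAt_snd)).abs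
    exact h2.eventually_lt (continuousAt_const (y := δ * η')) (by simp; positivity)
  obtain ⟨η₂, hη₂, hball⟩ := Metric.eventually_nhds_iff_ball.1 key
  set B := C' + δ * η' + (C + δ) * η' with hB
  have hBpos : 0 < B := by positivity
  refine ⟨min (min η₁ (η₂ / 2)) (min (η' / (8 * T * B)) (δ * η' / (C * T * B))),
    by positivity, fun ε hε hεle => ?_⟩
  have hε1 : |ε| ≤ η₁ := by
    rw [abs_of_pos hε]; exact hεle.trans ((min_le_left _ _).trans (min_le_left _ _))
  have hε2 : ε < η₂ := by
    have : ε ≤ η₂ / 2 := hεle.trans ((min_le_left _ _).trans (min_le_right _ _))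
    linarith
  have hε3 : ε * B * T ≤ η' / 8 := by
    have : ε ≤ η' / (8 * T * B) := hεle.trans ((min_le_right _ _).trans (min_le_left _ _))
    rw [le_div_iff₀ (by positivity)] at this
    linarith
  have hε4 : C * (ε * B * T) ≤ δ * η' := by
    have : ε ≤ δ * η' / (C * T * B) := hεle.trans ((min_le_right _ _).trans (min_le_right _ _))
    rw [le_div_iff₀ (by positivity)] at this
    linarith
  obtain ⟨H1, H2⟩ := H ε hε1
  have hη'ab : |h₀ - h₀| ≤ η' := by simpa using hη'0.le
  have hd0 : ∀ θ, |R ((h₀, ε), θ) - R ((h₀, 0), θ)| ≤ δ * η' := fun θ => by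
    refine (hball (h₀, ε) ?_ θ).le
    rw [Metric.mem_ball, Prod.dist_eq, dist_self, Real.dist_eq, sub_zero, abs_of_pos hε]
    exact max_lt hη₂ hε2
  have hlip : ∀ h₁ h₂ θ, |h₁ - h₀| ≤ η' → |h₂ - h₀| ≤ η' →
      |R ((h₁, ε), θ) - R ((h₂, ε), θ)| ≤ (C + δ) * |h₁ - h₂| := by
    intro h₁ h₂ θ a1 a2
    have b1 := H2 h₁ h₂ θ (a1.trans hη'1) (a2.trans hη'1)
    have b2 : |r₀ θ * (h₁ - h₂)| ≤ C * |h₁ - h₂| := by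
      rw [abs_mul]; exact mul_le_mul_of_nonneg_right (hCr θ) (abs_nonneg _)
    have b3 := abs_add_le (R ((h₁, ε), θ) - R ((h₂, ε), θ) - r₀ θ * (h₁ - h₂))
      (r₀ θ * (h₁ - h₂))
    rw [sub_add_cancel] at b3
    linarith
  have hbd : ∀ h θ, |h - h₀| ≤ η' → |R ((h, ε), θ)| ≤ B := by
    intro h θ a
    have b1 := hlip h h₀ θ a hη'ab
    have b2 := hd0 θ
    have b3 := hCR θ
    have b4 : (C + δ) * |h - h₀| ≤ (C + δ) * η' := mul_le_mul_of_nonneg_left a (by positivity)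
    rw [hB]
    rw [abs_le] at *
    constructor <;> linarith [b1.1, b1.2, b2.1, b2.2, b3.1, b3.2]
  refine ⟨?_, fun h₁ h₂ θ a1 a2 => H2 h₁ h₂ θ (a1.trans hη'1) (a2.trans hη'1)⟩
  have hmem : ∀ {a x : ℝ}, x ∈ Metric.closedBall h₀ a ↔ |x - h₀| ≤ a := by
    intro a x; rw [Metric.mem_closedBall, Real.dist_eq]
  set c : ℝ → ℝ := fun h => max (h₀ - η') (min (h₀ + η') h) with hc
  have hcm : ∀ h, |c h - h₀| ≤ η' := fun h => by
    rw [abs_le]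
    have h1 : h₀ - η' ≤ c h := le_max_left _ _
    have h2 : c h ≤ h₀ + η' := max_le (by linarith) (min_le_left _ _)
    constructor <;> linarith
  have hcl : ∀ x y, |c x - c y| ≤ |x - y| := fun x y =>
    (abs_max_sub_max_le_max _ _ _ _).trans (by
      have := abs_min_sub_min_le_max (h₀ + η') x (h₀ + η') y
      simpa using this)
  have hcid : ∀ h, |h - h₀| ≤ η' → c h = h := fun h hh => by
    rw [abs_le] at hh
    simp only [hc]
    rw [min_eq_right (by linarith), max_eq_right (by linarith)]
  have hPL : IsPicardLindelof (fun θ h => ε * R ((c h, ε), θ)) (tmin := 0) (tmax := T)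
      ⟨0, le_rfl, hT.le⟩ h₀ (3 / 4 * η').toNNReal (η' / 2).toNNReal (ε * B).toNNReal
      (ε * (C + δ)).toNNReal := by
    have e1 : ((3 / 4 * η').toNNReal : ℝ) = 3 / 4 * η' := Real.coe_toNNReal _ (by positivity)
    have e2 : ((η' / 2).toNNReal : ℝ) = η' / 2 := Real.coe_toNNReal _ (by positivity)
    have e3 : ((ε * B).toNNReal : ℝ) = ε * B := Real.coe_toNNReal _ (by positivity)
    have e4 : ((ε * (C + δ)).toNNReal : ℝ) = ε * (C + δ) := Real.coe_toNNReal _ (by positivity)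
    refine ⟨fun θ _ => LipschitzOnWith.of_dist_le_mul fun x hx y hy => ?_, fun x hx => ?_,
      fun θ _ x hx => ?_, ?_⟩
    · rw [e4, Real.dist_eq, Real.dist_eq, ← mul_sub, abs_mul, abs_of_pos hε, mul_assoc]
      exact mul_le_mul_of_nonneg_left ((hlip _ _ θ (hcm x) (hcm y)).trans
        (mul_le_mul_of_nonneg_left (hcl x y) (by positivity))) hε.le
    · exact (continuous_const.mul
        (continuous_slice fun θ => H1 _ θ ((hcm x).trans hη'1))).continuousOn
    · rw [e3, Real.norm_eq_abs, abs_mul, abs_of_pos hε]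
      exact mul_le_mul_of_nonneg_left (hbd _ θ (hcm x)) hε.le
    · rw [e1, e2, e3]
      simp only [sub_zero, sub_self]
      rw [max_eq_left hT.le]
      linarith
  obtain ⟨α, hα, L', hL'⟩ :=
    hPL.exists_forall_mem_closedBall_eq_hasDerivWithinAt_lipschitzOnWith
  have e2 : ((η' / 2).toNNReal : ℝ) = η' / 2 := Real.coe_toNNReal _ (by positivity)
  simp only [e2] at hα hL'
  have hconf : ∀ x, |x - h₀| ≤ η' / 2 → ∀ t ∈ Icc 0 T, |α x t - x| ≤ ε * B * T := by
    intro x hx t ht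
    have := (convex_Icc (0 : ℝ) T).norm_image_sub_le_of_norm_hasDerivWithin_le (C := ε * B)
      (fun t ht => (hα x (hmem.2 hx)).2 t ht) (fun t ht => by
        rw [Real.norm_eq_abs, abs_mul, abs_of_pos hε]
        exact mul_le_mul_of_nonneg_left (hbd _ t (hcm _)) hε.le)
      (left_mem_Icc.2 hT.le) ht
    rw [(hα x (hmem.2 hx)).1, sub_zero, Real.norm_eq_abs, Real.norm_eq_abs,
      abs_of_nonneg ht.1] at this
    exact this.trans (mul_le_mul_of_nonneg_left ht.2 (by positivity))
  have hconf' : ∀ x, |x - h₀| ≤ η' / 2 → ∀ t ∈ Icc 0 T, |α x t - h₀| ≤ 3 / 4 * η' := by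
    intro x hx t ht
    have h1 := hconf x hx t ht
    have h2 := abs_sub_le (α x t) x h₀
    linarith
  have hd : ∀ x, |x - h₀| ≤ η' / 2 → ∀ t ∈ Icc 0 T,
      HasDerivWithinAt (α x) (ε * R ((α x t, ε), t)) (Icc 0 T) t := by
    intro x hx t ht
    have := (hα x (hmem.2 hx)).2 t ht
    rwa [hcid _ ((hconf' x hx t ht).trans (by linarith))] at this
  have hdisp : ∀ x, |x - h₀| = η' / 2 → |α x T - x - ε * ((x - h₀) * m)| ≤
      ε * (T * (3 * δ * η')) := by
    intro x hx
    have hv : ∀ t ∈ Icc 0 T, |R ((α x t, ε), t) - (R ((h₀, 0), t) + r₀ t * (x - h₀))|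
        ≤ 3 * δ * η' := by
      intro t ht
      have b1 := H2 (α x t) h₀ t ((hconf' x hx.le t ht).trans (by linarith)) (hη'ab.trans hη'1)
      have b2 := hd0 t
      have b3 : |r₀ t * (α x t - x)| ≤ C * (ε * B * T) := by
        rw [abs_mul]
        exact mul_le_mul (hCr t) (hconf x hx.le t ht) (abs_nonneg _) hC.le
      have b4 : δ * |α x t - h₀| ≤ δ * η' :=
        mul_le_mul_of_nonneg_left ((hconf' x hx.le t ht).trans (by linarith)) hδ.le
      have b5 : R ((α x t, ε), t) - (R ((h₀, 0), t) + r₀ t * (x - h₀)) =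
        (R ((α x t, ε), t) - R ((h₀, ε), t) - r₀ t * (α x t - h₀)) +
        (R ((h₀, ε), t) - R ((h₀, 0), t)) + r₀ t * (α x t - x) := by ring
      rw [b5]
      refine (abs_add_three _ _ _).trans ?_
      linarith
    have hD : ∀ t ∈ Icc 0 T, HasDerivWithinAt
        (fun t => α x t - ε * ∫ s in (0 : ℝ)..t, (R ((h₀, 0), s) + r₀ s * (x - h₀)))
        (ε * R ((α x t, ε), t) - ε * (R ((h₀, 0), t) + r₀ t * (x - h₀))) (Icc 0 T) t := by
      intro t ht
      have hcc : Continuous fun s => R ((h₀, 0), s) + r₀ s * (x - h₀) :=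
        hRc.add (hr₀c.mul continuous_const)
      exact (hd x hx.le t ht).sub
        ((hcc.integral_hasStrictDerivAt 0 t).hasDerivAt.const_mul ε).hasDerivWithinAt
    have := (convex_Icc (0 : ℝ) T).norm_image_sub_le_of_norm_hasDerivWithin_le
      (C := ε * (3 * δ * η')) hD (fun t ht => by
        rw [← mul_sub, Real.norm_eq_abs, abs_mul, abs_of_pos hε]
        exact mul_le_mul_of_nonneg_left (hv t ht) hε.le)
      (left_mem_Icc.2 hT.le) (right_mem_Icc.2 hT.le)
    have hint : ∫ s in (0 : ℝ)..T, (R ((h₀, 0), s) + r₀ s * (x - h₀)) = m * (x - h₀) := by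
      rw [intervalIntegral.integral_add (hRc.intervalIntegrable _ _)
        ((hr₀c.intervalIntegrable _ _).mul_const _), h0,
        intervalIntegral.integral_mul_const, ← hm, zero_add]
    rw [(hα x (hmem.2 hx.le)).1, hint, intervalIntegral.integral_same, sub_zero,
      Real.norm_eq_abs, Real.norm_eq_abs, abs_of_pos hT] at this
    refine (le_of_eq ?_).trans (this.trans (le_of_eq ?_))
    · congr 1; ring
    · ring
  have hsmall : ε * (T * (3 * δ * η')) < ε * (η' / 2 * |m|) := by
    refine mul_lt_mul_of_pos_left ?_ hε
    have : T * (3 * δ * η') = 3 * η' * (T * δ) := by ring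
    rw [this, hTδ]
    nlinarith [mul_pos hη'0 hmp]
  have hcont : ContinuousOn (fun x => α x T - x) (Icc (h₀ - η' / 2) (h₀ + η' / 2)) := by
    have := (hL' T (right_mem_Icc.2 hT.le)).continuousOn
    rw [Real.closedBall_eq_Icc] at this
    exact this.sub continuousOn_id
  obtain ⟨x, hx, hfix⟩ : ∃ x ∈ Icc (h₀ - η' / 2) (h₀ + η' / 2), α x T - x = 0 := by
    have hle : h₀ - η' / 2 ≤ h₀ + η' / 2 := by linarith
    have d1 := hdisp (h₀ - η' / 2) (by rw [show h₀ - η' / 2 - h₀ = -(η' / 2) by ring, abs_neg,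
      abs_of_pos (by positivity)])
    have d2 := hdisp (h₀ + η' / 2) (by rw [show h₀ + η' / 2 - h₀ = η' / 2 by ring,
      abs_of_pos (by positivity)])
    rw [show h₀ - η' / 2 - h₀ = -(η' / 2) by ring, abs_le] at d1
    rw [show h₀ + η' / 2 - h₀ = η' / 2 by ring, abs_le] at d2
    rcases lt_or_gt_of_ne hm0 with hneg | hpos
    · rw [abs_of_neg hneg] at hsmall
      refine intermediate_value_Icc' hle hcont ⟨?_, ?_⟩ <;> nlinarith
    · rw [abs_of_pos hpos] at hsmall
      refine intermediate_value_Icc hle hcont ⟨?_, ?_⟩ <;> nlinarith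
  have hx' : |x - h₀| ≤ η' / 2 := by rw [abs_le]; constructor <;> linarith [hx.1, hx.2]
  have hF : ∀ t, ∀ y ∈ {x | |x - h₀| < η'},
      ContinuousAt (fun p : ℝ × ℝ => ε * R ((p.2, ε), p.1)) (t, y) := fun t y hy =>
    continuousAt_const.mul (ContinuousAt.comp (g := R) (f := fun p : ℝ × ℝ => ((p.2, ε), p.1))
      (x := (t, y)) (H1 y t ((le_of_lt hy).trans hη'1)) (by fun_prop))
  have hper' : ∀ t x, ε * R ((x, ε), t + T) = ε * R ((x, ε), t) := fun t x => by rw [hper]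
  exact exists_periodic_extension (F := fun t x => ε * R ((x, ε), t))
    (s := {x | |x - h₀| < η'}) hT (hd x hx')
    (by rw [(hα x (hmem.2 hx')).1]; linarith) hper'
    (fun t ht => (hconf' x hx' t ht).trans_lt (by linarith)) hF

/-- Uniqueness part of the averaging theorem: a solution which closes up after `k` turns coincides
with a given periodic one, along any increasing reparametrisation `φ` of the angle. -/
theorem eq_periodic_solution_of_linear_approx {F : ℝ → ℝ → ℝ} {r₀ β φ h w : ℝ → ℝ}
    {T ε δ τ : ℝ} {k : ℤ} (hε : 0 < ε) (hr₀ : Continuous r₀) (hT : 0 < T)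
    (hr₀per : Function.Periodic r₀ T)
    (hδ : T * δ < |∫ θ in (0 : ℝ)..T, r₀ θ|)
    (hβper : Function.Periodic β T) (hβ : ∀ θ, HasDerivAt β (ε * F (β θ) θ) θ)
    (hφ : ∀ t, HasDerivAt φ (w t) t) (hw : ∀ t, 0 < w t)
    (hh : ∀ t, HasDerivAt h (ε * F (h t) (φ t) * w t) t)
    (happ : ∀ t, |F (h t) (φ t) - F (β (φ t)) (φ t) - r₀ (φ t) * (h t - β (φ t))|
      ≤ δ * |h t - β (φ t)|)
    (hk : 0 < k) (hτh : h τ = h 0) (hτφ : φ τ = φ 0 + k * T) (t : ℝ) : h t = β (φ t) := by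
  set d : ℝ → ℝ := fun t => h t - β (φ t) with hd
  obtain ⟨C, hC, hCr⟩ := exists_bound_of_periodic hT hr₀ hr₀per
  have hdd : ∀ t, HasDerivAt d (ε * (F (h t) (φ t) - F (β (φ t)) (φ t)) * w t) t := fun t => by
    have := (hh t).sub ((hβ (φ t)).comp t (hφ t))
    exact this.congr_deriv (by ring)
  have hφm : Monotone φ := monotone_of_hasDerivAt_nonneg hφ fun t => (hw t).le
  have hlip : ∀ t, |F (h t) (φ t) - F (β (φ t)) (φ t)| ≤ (C + δ) * |d t| := fun t => by
    have b2 : |r₀ (φ t) * d t| ≤ C * |d t| := by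
      rw [abs_mul]; exact mul_le_mul_of_nonneg_right (hCr _) (abs_nonneg _)
    have b3 := abs_add_le (F (h t) (φ t) - F (β (φ t)) (φ t) - r₀ (φ t) * d t) (r₀ (φ t) * d t)
    rw [sub_add_cancel] at b3
    linarith [happ t]
  by_cases hz : ∃ t₀, d t₀ = 0
  · obtain ⟨t₀, ht₀⟩ := hz
    have hE : ∀ c : ℝ, ∀ t, HasDerivAt (fun t => d t ^ 2 * exp (c * φ t))
        ((2 * d t * (ε * (F (h t) (φ t) - F (β (φ t)) (φ t)) * w t) + d t ^ 2 * (c * w t)) *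
          exp (c * φ t)) t := fun c t => by
      have := ((hdd t).pow 2).mul ((hφ t).const_mul c).exp
      exact this.congr_deriv (by simp; ring)
    have hdl : ∀ t, |2 * d t * (ε * (F (h t) (φ t) - F (β (φ t)) (φ t)) * w t)|
        ≤ 2 * ε * (C + δ) * w t * d t ^ 2 := fun t => by
      rw [abs_mul, abs_mul, abs_mul, abs_mul, abs_of_pos hε, abs_of_pos (hw t), abs_two,
        ← sq_abs (d t)]
      have := mul_le_mul_of_nonneg_left (hlip t)
        (mul_nonneg (mul_nonneg (by positivity : 0 ≤ 2 * ε) (hw t).le) (abs_nonneg (d t)))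
      linarith
    have hzero : d t = 0 := by
      have hexp : ∀ c, 0 < exp (c * φ t) := fun c => exp_pos _
      rcases le_total t₀ t with hle | hle
      · have hanti : Antitone fun t => d t ^ 2 * exp (-(2 * ε * (C + δ)) * φ t) :=
          antitone_of_hasDerivAt_nonpos (hE _) fun t => mul_nonpos_of_nonpos_of_nonneg
            (by linarith [(abs_le.1 (hdl t)).2]) (exp_pos _).le
        have := hanti hle
        simp only [ht₀] at this
        have h0 : d t ^ 2 ≤ 0 := by
          by_contra hcon
          have := mul_pos (not_le.1 hcon) (hexp (-(2 * ε * (C + δ))))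
          linarith
        nlinarith
      · have hmono : Monotone fun t => d t ^ 2 * exp ((2 * ε * (C + δ)) * φ t) :=
          monotone_of_hasDerivAt_nonneg (hE _) fun t => mul_nonneg
            (by linarith [(abs_le.1 (hdl t)).1]) (exp_pos _).le
        have := hmono hle
        simp only [ht₀] at this
        have h0 : d t ^ 2 ≤ 0 := by
          by_contra hcon
          have := mul_pos (not_le.1 hcon) (hexp (2 * ε * (C + δ)))
          linarith
        nlinarith
    exact sub_eq_zero.1 hzero
  · exfalso
    push Not at hz
    set P : ℝ → ℝ := fun x => ∫ s in (0 : ℝ)..x, r₀ s with hP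
    have hPd : ∀ x, HasDerivAt P (r₀ x) x := fun x => (hr₀.integral_hasStrictDerivAt 0 x).hasDerivAt
    have hPk : P (φ τ) - P (φ 0) = k * ∫ θ in (0 : ℝ)..T, r₀ θ := by
      rw [hP, hτφ]
      dsimp only
      rw [intervalIntegral.integral_interval_sub_left (hr₀.intervalIntegrable _ _)
        (hr₀.intervalIntegrable _ _)]
      have := hr₀per.intervalIntegral_add_zsmul_eq k (φ 0)
        (fun _ _ => hr₀.intervalIntegrable _ _)
      have h2 := hr₀per.intervalIntegral_add_eq (φ 0) 0
      rw [zero_add] at h2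
      rw [h2] at this
      simpa using this
    set D : ℝ → ℝ := fun t => ε * (F (h t) (φ t) - F (β (φ t)) (φ t)) * w t / d t -
      ε * (r₀ (φ t) * w t) with hD
    have hW : ∀ c t, HasDerivAt (fun t => log (d t) - ε * P (φ t) + c * φ t) (D t + c * w t) t :=
      fun c t => (((hdd t).log (hz t)).sub (((hPd (φ t)).comp t (hφ t)).const_mul ε)).add
        ((hφ t).const_mul c)
    have hDb : ∀ t, |D t| ≤ ε * δ * w t := fun t => by
      have : D t = ε * w t * (F (h t) (φ t) - F (β (φ t)) (φ t) - r₀ (φ t) * d t) / d t := by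
        rw [hD]; field_simp [hz t]
      rw [this, abs_div, div_le_iff₀ (abs_pos.2 (hz t)), abs_mul, abs_mul, abs_of_pos hε,
        abs_of_pos (hw t)]
      have := mul_le_mul_of_nonneg_left (happ t) (mul_pos hε (hw t)).le
      linarith
    have hdτ : d τ = d 0 := by
      simp only [hd]
      rw [hτh, hτφ, hβper.int_mul k (φ 0)]
    have hkR : (0 : ℝ) < k := by exact_mod_cast hk
    have hφτ : φ τ - φ 0 = k * T := by linarith
    have hτ : 0 ≤ τ := by
      by_contra hcon
      have := hφm (le_of_lt (not_le.1 hcon))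
      have := mul_pos hkR hT
      linarith
    have m1 : Monotone fun t => log (d t) - ε * P (φ t) + (ε * δ) * φ t :=
      monotone_of_hasDerivAt_nonneg (hW _) fun t => by
        change 0 ≤ D t + ε * δ * w t
        linarith [(abs_le.1 (hDb t)).1]
    have m2 : Antitone fun t => log (d t) - ε * P (φ t) + (-(ε * δ)) * φ t :=
      antitone_of_hasDerivAt_nonpos (hW _) fun t => by
        change D t + -(ε * δ) * w t ≤ 0
        linarith [(abs_le.1 (hDb t)).2]
    have a1 := m1 hτ
    have a2 := m2 hτ
    simp only [hdτ] at a1 a2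
    set m := ∫ θ in (0 : ℝ)..T, r₀ θ
    have a3 : ε * k * |m| ≤ ε * k * (T * δ) := by
      rw [← abs_of_pos (mul_pos hε hkR), ← abs_mul, abs_of_pos (mul_pos hε hkR), abs_le]
      have e1 : ε * P (φ τ) - ε * P (φ 0) = ε * k * m := by rw [← mul_sub, hPk]; ring
      have e2 : ε * δ * φ τ - ε * δ * φ 0 = ε * k * (T * δ) := by rw [← mul_sub, hφτ]; ring
      constructor <;> linarith
    exact absurd (le_of_mul_le_mul_left a3 (mul_pos hε hkR)) (not_le.2 hδ)

/-- The levels `y² / 2 + G x = h`, `hm < h < hp`, have an oval over `(a, b)` which is star-shaped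
about `(x₀, 0)`; here `g` is the derivative of `G`. -/
structure IsAnnulus (G g : ℝ → ℝ) (x₀ a b hm hp : ℝ) : Prop where
  left_lt : a < x₀
  lt_right : x₀ < b
  low : G x₀ ≤ hm
  high_left : hp ≤ G a
  high_right : hp ≤ G b
  star : ∀ x ∈ Ioo a b, ∀ h ∈ Ioo hm hp, G x ≤ h → 0 < (x - x₀) * g x + 2 * (h - G x)

/-- `ρ` is the radius, in the direction `θ`, of the oval of level `h` over `(a, b)`. -/
def IsRadius (G : ℝ → ℝ) (x₀ a b h θ ρ : ℝ) : Prop :=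
  0 < ρ ∧ x₀ + ρ * cos θ ∈ Ioo a b ∧ (ρ * sin θ) ^ 2 / 2 + G (x₀ + ρ * cos θ) = h

section
variable {G g : ℝ → ℝ} {x₀ a b hm hp : ℝ}

theorem hasDerivAt_energy_ray (hG : ∀ x, HasDerivAt G (g x) x) (x₀ θ ρ : ℝ) :
    HasDerivAt (fun ρ => (ρ * sin θ) ^ 2 / 2 + G (x₀ + ρ * cos θ))
      (ρ * sin θ ^ 2 + g (x₀ + ρ * cos θ) * cos θ) ρ := by
  have h1 : HasDerivAt (fun ρ => x₀ + ρ * cos θ) (cos θ) ρ := by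
    simpa using ((hasDerivAt_id ρ).mul_const (cos θ)).const_add x₀
  have h2 := (((hasDerivAt_id ρ).mul_const (sin θ)).pow 2).div_const 2
  refine (h2.add ((hG _).comp ρ h1)).congr_deriv ?_
  simp
  ring

theorem IsAnnulus.ray_deriv_pos (H : IsAnnulus G g x₀ a b hm hp) {h θ ρ : ℝ} (hh : h ∈ Ioo hm hp)
    (hρ : IsRadius G x₀ a b h θ ρ) : 0 < ρ * sin θ ^ 2 + g (x₀ + ρ * cos θ) * cos θ := by
  obtain ⟨h0, h1, h2⟩ := hρ
  have := H.star _ h1 h hh (by linarith [sq_nonneg (ρ * sin θ)])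
  refine pos_of_mul_pos_right (a := ρ) ?_ h0.le
  rw [← h2] at this
  linarith

theorem add_mul_mem_Ioo {x₀ c ρ₁ ρ₂ ρ : ℝ} (h1 : x₀ + ρ₁ * c ∈ Ioo a b)
    (h2 : x₀ + ρ₂ * c ∈ Ioo a b) (hρ : ρ ∈ Icc ρ₁ ρ₂) : x₀ + ρ * c ∈ Ioo a b := by
  obtain ⟨h1, h1'⟩ := h1
  obtain ⟨h2, h2'⟩ := h2
  obtain ⟨h3, h3'⟩ := hρ
  rcases le_total 0 c with hc | hc
  · have := mul_le_mul_of_nonneg_right h3 hc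
    have := mul_le_mul_of_nonneg_right h3' hc
    constructor <;> linarith
  · have := mul_le_mul_of_nonpos_right h3 hc
    have := mul_le_mul_of_nonpos_right h3' hc
    constructor <;> linarith

theorem IsAnnulus.le_energy (H : IsAnnulus G g x₀ a b hm hp) (hG : ∀ x, HasDerivAt G (g x) x)
    {h θ ρ ρ' : ℝ} (hh : h ∈ Ioo hm hp) (hρ : IsRadius G x₀ a b h θ ρ) (hle : ρ ≤ ρ')
    (hρ' : x₀ + ρ' * cos θ ∈ Ioo a b) : h ≤ (ρ' * sin θ) ^ 2 / 2 + G (x₀ + ρ' * cos θ) := by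
  refine image_le_of_deriv_right_lt_deriv_boundary' (f := fun _ => h) (f' := fun _ => 0)
    (a := ρ) (b := ρ') continuousOn_const (fun x _ => hasDerivWithinAt_const _ _ _)
    (B := fun ρ => (ρ * sin θ) ^ 2 / 2 + G (x₀ + ρ * cos θ)) hρ.2.2.ge
    (fun x _ => (hasDerivAt_energy_ray hG x₀ θ x).continuousAt.continuousWithinAt)
    (fun x _ => (hasDerivAt_energy_ray hG x₀ θ x).hasDerivWithinAt) (fun x hx hhx => ?_)
    (right_mem_Icc.2 hle)
  exact H.ray_deriv_pos hh ⟨hρ.1.trans_le hx.1,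
    add_mul_mem_Ioo hρ.2.1 hρ' (Ico_subset_Icc_self hx), hhx.symm⟩

theorem IsAnnulus.radius_le (H : IsAnnulus G g x₀ a b hm hp) (hG : ∀ x, HasDerivAt G (g x) x)
    {h θ ρ ρ' : ℝ} (hh : h ∈ Ioo hm hp) (hρ : IsRadius G x₀ a b h θ ρ)
    (hρ' : IsRadius G x₀ a b h θ ρ') : ρ' ≤ ρ := by
  by_contra! hlt
  have hd := hasDerivAt_energy_ray hG x₀ θ ρ'
  have hpos := H.ray_deriv_pos hh hρ'
  have := eventually_nhdsWithin_sign_eq_of_deriv_pos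
    (f := fun ρ => (ρ * sin θ) ^ 2 / 2 + G (x₀ + ρ * cos θ) - h)
    (by rw [(hd.sub_const h).deriv]; exact hpos) (by simp [hρ'.2.2])
  have h1 := this.filter_mono (nhdsWithin_le_nhds (s := Iio ρ'))
  obtain ⟨x, hx, hx1⟩ := (h1.and (Ioo_mem_nhdsLT hlt)).exists
  rw [sign_neg (by linarith [hx1.2] : x - ρ' < 0), sign_eq_neg_one_iff] at hx
  have := H.le_energy hG hh hρ hx1.1.le (add_mul_mem_Ioo hρ.2.1 hρ'.2.1 ⟨hx1.1.le, hx1.2.le⟩)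
  linarith

theorem IsAnnulus.radius_unique (H : IsAnnulus G g x₀ a b hm hp) (hG : ∀ x, HasDerivAt G (g x) x)
    {h θ ρ ρ' : ℝ} (hh : h ∈ Ioo hm hp) (hρ : IsRadius G x₀ a b h θ ρ)
    (hρ' : IsRadius G x₀ a b h θ ρ') : ρ = ρ' :=
  le_antisymm (H.radius_le hG hh hρ' hρ) (H.radius_le hG hh hρ hρ')

theorem IsAnnulus.exists_radius (H : IsAnnulus G g x₀ a b hm hp)
    (hG : ∀ x, HasDerivAt G (g x) x) {h : ℝ} (θ : ℝ) (hh : h ∈ Ioo hm hp) :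
    ∃ ρ, IsRadius G x₀ a b h θ ρ := by
  have hx₀ : x₀ ∈ Ioo a b := ⟨H.left_lt, H.lt_right⟩
  have key : ∀ r, 0 ≤ r → h ≤ (r * sin θ) ^ 2 / 2 + G (x₀ + r * cos θ) →
      (∀ ρ ∈ Ico 0 r, x₀ + ρ * cos θ ∈ Ioo a b) →
      (x₀ + r * cos θ ∈ Ioo a b ∨ h < (r * sin θ) ^ 2 / 2 + G (x₀ + r * cos θ)) →
      ∃ ρ, IsRadius G x₀ a b h θ ρ := by
    intro r hr h1 h2 h3
    have hc : ContinuousOn (fun ρ => (ρ * sin θ) ^ 2 / 2 + G (x₀ + ρ * cos θ)) (Icc 0 r) :=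
      fun x _ => (hasDerivAt_energy_ray hG x₀ θ x).continuousAt.continuousWithinAt
    obtain ⟨ρ, hρ, hρh⟩ := intermediate_value_Icc hr hc (show h ∈ Icc _ _ from
      ⟨by simpa using H.low.trans hh.1.le, h1⟩)
    have hρ0 : ρ ≠ 0 := by
      rintro rfl
      simp at hρh
      linarith [H.low, hh.1]
    refine ⟨ρ, lt_of_le_of_ne hρ.1 hρ0.symm, ?_, hρh⟩
    rcases hρ.2.lt_or_eq with hlt | rfl
    · exact h2 ρ ⟨hρ.1, hlt⟩
    · rcases h3 with h3 | h3
      · exact h3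
      · simp only at hρh; linarith
  rcases lt_trichotomy (cos θ) 0 with hc | hc | hc
  · have e : x₀ + (a - x₀) / cos θ * cos θ = a := by field_simp [hc.ne]; ring
    have h4 : h < ((a - x₀) / cos θ * sin θ) ^ 2 / 2 + G (x₀ + (a - x₀) / cos θ * cos θ) := by
      rw [e]; linarith [H.high_left, hh.2, sq_nonneg ((a - x₀) / cos θ * sin θ)]
    refine key ((a - x₀) / cos θ) (div_nonneg_of_nonpos (by linarith [hx₀.1]) hc.le) h4.le
      (fun ρ hρ => ?_) (Or.inr h4)
    have := mul_lt_mul_of_neg_right hρ.2 hc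
    have := mul_nonpos_of_nonneg_of_nonpos hρ.1 hc.le
    constructor <;> linarith [hx₀.1, hx₀.2]
  · have hs : sin θ ^ 2 = 1 := by rw [sin_sq, hc]; ring
    refine key (√(2 * (h - G x₀))) (sqrt_nonneg _) ?_ (fun ρ _ => by simpa [hc] using hx₀)
      (Or.inl (by simpa [hc] using hx₀))
    rw [mul_pow, hs, sq_sqrt (by linarith [H.low, hh.1]), hc]
    simp
  · have e : x₀ + (b - x₀) / cos θ * cos θ = b := by field_simp [hc.ne']; ring
    have h4 : h < ((b - x₀) / cos θ * sin θ) ^ 2 / 2 + G (x₀ + (b - x₀) / cos θ * cos θ) := by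
      rw [e]; linarith [H.high_right, hh.2, sq_nonneg ((b - x₀) / cos θ * sin θ)]
    refine key ((b - x₀) / cos θ) (div_nonneg (by linarith [hx₀.2]) hc.le) h4.le
      (fun ρ hρ => ?_) (Or.inr h4)
    have := mul_lt_mul_of_pos_right hρ.2 hc
    have := mul_nonneg hρ.1 hc.le
    constructor <;> linarith [hx₀.1, hx₀.2]

end

open Classical in
/-- The radius in the direction `θ` of the oval of level `h`. -/
noncomputable def radius (G : ℝ → ℝ) (x₀ a b h θ : ℝ) : ℝ :=
  if H : ∃ ρ, IsRadius G x₀ a b h θ ρ then H.choose else 1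

theorem radius_add_two_pi (G : ℝ → ℝ) (x₀ a b h θ : ℝ) :
    radius G x₀ a b h (θ + 2 * π) = radius G x₀ a b h θ := by
  have : IsRadius G x₀ a b h (θ + 2 * π) = IsRadius G x₀ a b h θ := by
    funext ρ
    simp only [IsRadius, cos_add_two_pi, sin_add_two_pi]
  unfold radius
  rw [this]

section
variable {G g : ℝ → ℝ} {x₀ a b hm hp : ℝ}

theorem IsAnnulus.isRadius_radius (H : IsAnnulus G g x₀ a b hm hp)
    (hG : ∀ x, HasDerivAt G (g x) x) {h : ℝ} (θ : ℝ) (hh : h ∈ Ioo hm hp) :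
    IsRadius G x₀ a b h θ (radius G x₀ a b h θ) := by
  rw [radius, dif_pos (H.exists_radius hG θ hh)]
  exact (H.exists_radius hG θ hh).choose_spec

theorem IsAnnulus.radius_eq (H : IsAnnulus G g x₀ a b hm hp)
    (hG : ∀ x, HasDerivAt G (g x) x) {h θ ρ : ℝ} (hh : h ∈ Ioo hm hp)
    (hρ : IsRadius G x₀ a b h θ ρ) : radius G x₀ a b h θ = ρ :=
  H.radius_unique hG hh (H.isRadius_radius hG θ hh) hρ

theorem IsAnnulus.contDiffAt_radius (H : IsAnnulus G g x₀ a b hm hp)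
    (hG : ∀ x, HasDerivAt G (g x) x) (hGc : ContDiff ℝ 1 G) {h θ : ℝ} (hh : h ∈ Ioo hm hp) :
    ContDiffAt ℝ 1 (fun p : ℝ × ℝ => radius G x₀ a b p.1 p.2) (h, θ) := by
  set ρ := radius G x₀ a b h θ with hρdef
  have hρ : IsRadius G x₀ a b h θ ρ := H.isRadius_radius hG θ hh
  set Φ : (ℝ × ℝ) × ℝ → ℝ := fun z =>
    (z.2 * sin z.1.2) ^ 2 / 2 + G (x₀ + z.2 * cos z.1.2) - z.1.1 with hΦ
  have hΦc : ContDiff ℝ 1 Φ := by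
    have : ContDiff ℝ 1 fun z : (ℝ × ℝ) × ℝ => G (x₀ + z.2 * cos z.1.2) :=
      hGc.comp (by fun_prop)
    exact (ContDiff.add (by fun_prop) this).sub (by fun_prop)
  have cdf : ContDiffAt ℝ 1 Φ ((h, θ), ρ) := hΦc.contDiffAt
  have hD : HasDerivAt (fun r => Φ ((h, θ), r))
      (ρ * sin θ ^ 2 + g (x₀ + ρ * cos θ) * cos θ) ρ :=
    (hasDerivAt_energy_ray hG x₀ θ ρ).sub_const h
  have hD2 : HasDerivAt (fun r => Φ ((h, θ), r))
      (fderiv ℝ Φ ((h, θ), ρ) (0, 1)) ρ :=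
    HasFDerivAt.comp_hasDerivAt (f := fun r : ℝ => ((h, θ), r)) ρ
      (cdf.differentiableAt (by simp)).hasFDerivAt
        ((hasDerivAt_const ρ (h, θ)).prodMk (hasDerivAt_id ρ))
  have hpos := H.ray_deriv_pos hh hρ
  rw [hD.unique hD2] at hpos
  have hinv : (fderiv ℝ Φ ((h, θ), ρ) ∘L .inr ℝ (ℝ × ℝ) ℝ).IsInvertible := by
    refine ⟨ContinuousLinearEquiv.unitsEquivAut ℝ (Units.mk0 _ hpos.ne'), ?_⟩
    ext
    simp
  have h1 := cdf.contDiffAt_implicitFunction one_ne_zero hinv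
  have h2 := cdf.eventually_apply_implicitFunction one_ne_zero hinv
  have h3 := cdf.implicitFunction_apply_self one_ne_zero hinv
  set ψ := cdf.implicitFunction one_ne_zero hinv
  simp only at h1 h2 h3
  refine h1.congr_of_eventuallyEq ?_
  have hψc := h1.continuousAt
  have e1 : ∀ᶠ p in 𝓝 (h, θ), 0 < ψ p := by
    have := hψc.tendsto
    rw [h3] at this
    exact this.eventually (lt_mem_nhds hρ.1)
  have e2 : ∀ᶠ p in 𝓝 (h, θ), x₀ + ψ p * cos p.2 ∈ Ioo a b := by
    have : ContinuousAt (fun p : ℝ × ℝ => x₀ + ψ p * cos p.2) (h, θ) :=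
      continuousAt_const.add (hψc.mul (by fun_prop))
    refine this.eventually_mem (isOpen_Ioo.mem_nhds ?_)
    simpa only [h3] using hρ.2.1
  have e3 : ∀ᶠ p : ℝ × ℝ in 𝓝 (h, θ), p.1 ∈ Ioo hm hp :=
    continuousAt_fst.eventually_mem (isOpen_Ioo.mem_nhds hh)
  filter_upwards [e1, e2, e3, h2] with p p1 p2 p3 p4
  refine H.radius_eq hG p3 ⟨p1, p2, ?_⟩
  simp only [hΦ, hρ.2.2] at p4
  linarith

end

/-- `ρ² dθ/dt` at the point with polar coordinates `x = x₀ + ρ cos θ`, `y = -ρ sin θ`. -/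
noncomputable def angularRate (g f : ℝ → ℝ) (x₀ ε ρ θ : ℝ) : ℝ :=
  ρ * cos θ * g (x₀ + ρ * cos θ) + (ρ * sin θ) ^ 2
    - ε * f (x₀ + ρ * cos θ) * (ρ * cos θ) * (ρ * sin θ)

/-- `ε⁻¹ dh/dθ` for the energy `h`, as a function of `((h, ε), θ)`. -/
noncomputable def energyRate (G g f : ℝ → ℝ) (x₀ a b : ℝ) (p : (ℝ × ℝ) × ℝ) : ℝ :=
  -(f (x₀ + radius G x₀ a b p.1.1 p.2 * cos p.2) *
    (radius G x₀ a b p.1.1 p.2 * sin p.2) ^ 2 * radius G x₀ a b p.1.1 p.2 ^ 2) /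
    angularRate g f x₀ p.1.2 (radius G x₀ a b p.1.1 p.2) p.2

theorem energyRate_periodic (G g f : ℝ → ℝ) (x₀ a b : ℝ) (p : ℝ × ℝ) (θ : ℝ) :
    energyRate G g f x₀ a b (p, θ + 2 * π) = energyRate G g f x₀ a b (p, θ) := by
  simp only [energyRate, angularRate, radius_add_two_pi, cos_add_two_pi, sin_add_two_pi]

section
variable {G g f : ℝ → ℝ} {x₀ a b hm hp : ℝ}

theorem IsAnnulus.angularRate_pos (H : IsAnnulus G g x₀ a b hm hp)
    (hG : ∀ x, HasDerivAt G (g x) x) {h : ℝ} (θ : ℝ) (hh : h ∈ Ioo hm hp) :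
    0 < angularRate g f x₀ 0 (radius G x₀ a b h θ) θ := by
  have h1 := H.isRadius_radius hG θ hh
  have := mul_pos h1.1 (H.ray_deriv_pos hh h1)
  unfold angularRate
  linarith

theorem IsAnnulus.contDiffAt_angularRate (H : IsAnnulus G g x₀ a b hm hp)
    (hG : ∀ x, HasDerivAt G (g x) x) (hGc : ContDiff ℝ 1 G) (hg : ContDiff ℝ 1 g)
    (hf : ContDiff ℝ 1 f) {h ε θ : ℝ} (hh : h ∈ Ioo hm hp) :
    ContDiffAt ℝ 1 (fun p : (ℝ × ℝ) × ℝ =>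
      angularRate g f x₀ p.1.2 (radius G x₀ a b p.1.1 p.2) p.2) ((h, ε), θ) := by
  have hr : ContDiffAt ℝ 1 (fun p : (ℝ × ℝ) × ℝ => radius G x₀ a b p.1.1 p.2) ((h, ε), θ) :=
    ContDiffAt.comp (g := fun p : ℝ × ℝ => radius G x₀ a b p.1 p.2)
      (f := fun p : (ℝ × ℝ) × ℝ => (p.1.1, p.2)) ((h, ε), θ) (H.contDiffAt_radius hG hGc hh)
      (by fun_prop)
  have hx : ContDiffAt ℝ 1 (fun p : (ℝ × ℝ) × ℝ => x₀ + radius G x₀ a b p.1.1 p.2 * cos p.2)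
      ((h, ε), θ) := by fun_prop
  have h1 := hg.contDiffAt.comp _ hx
  have h2 := hf.contDiffAt.comp _ hx
  simp only [Function.comp_def] at h1 h2
  unfold angularRate
  fun_prop

theorem IsAnnulus.contDiffAt_energyRate (H : IsAnnulus G g x₀ a b hm hp)
    (hG : ∀ x, HasDerivAt G (g x) x) (hGc : ContDiff ℝ 1 G) (hg : ContDiff ℝ 1 g)
    (hf : ContDiff ℝ 1 f) {h : ℝ} (θ : ℝ) (hh : h ∈ Ioo hm hp) :
    ContDiffAt ℝ 1 (energyRate G g f x₀ a b) ((h, 0), θ) := by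
  have hr : ContDiffAt ℝ 1 (fun p : (ℝ × ℝ) × ℝ => radius G x₀ a b p.1.1 p.2) ((h, 0), θ) :=
    ContDiffAt.comp (g := fun p : ℝ × ℝ => radius G x₀ a b p.1 p.2)
      (f := fun p : (ℝ × ℝ) × ℝ => (p.1.1, p.2)) ((h, 0), θ) (H.contDiffAt_radius hG hGc hh)
      (by fun_prop)
  have hx : ContDiffAt ℝ 1 (fun p : (ℝ × ℝ) × ℝ => x₀ + radius G x₀ a b p.1.1 p.2 * cos p.2)
      ((h, 0), θ) := by fun_prop
  have h2 := hf.contDiffAt.comp _ hx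
  simp only [Function.comp_def] at h2
  refine ContDiffAt.div (by fun_prop) (H.contDiffAt_angularRate hG hGc hg hf hh) ?_
  exact (H.angularRate_pos hG θ hh).ne'

theorem IsAnnulus.eventually_angularRate_pos (H : IsAnnulus G g x₀ a b hm hp)
    (hG : ∀ x, HasDerivAt G (g x) x) (hGc : ContDiff ℝ 1 G) (hg : ContDiff ℝ 1 g)
    (hf : ContDiff ℝ 1 f) {h : ℝ} (hh : h ∈ Ioo hm hp) :
    ∀ᶠ p : ℝ × ℝ in 𝓝 (h, 0), ∀ θ, 0 < angularRate g f x₀ p.2 (radius G x₀ a b p.1 θ) θ := by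
  refine eventually_forall_of_periodic two_pi_pos (fun p θ => ?_) fun θ => ?_
  · simp only [angularRate, radius_add_two_pi, cos_add_two_pi, sin_add_two_pi]
  · exact (H.contDiffAt_angularRate hG hGc hg hf (ε := 0) (θ := θ) hh).continuousAt.eventually
      (lt_mem_nhds (H.angularRate_pos hG θ hh))

/-- A curve of varying energy `β` satisfying the angular equation solves the planar system up to
reparametrisation: equation for the radius. -/
theorem IsAnnulus.hasDerivAt_radius (H : IsAnnulus G g x₀ a b hm hp)
    (hG : ∀ x, HasDerivAt G (g x) x) (hGc : ContDiff ℝ 1 G) {β : ℝ → ℝ} {ε θ : ℝ}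
    (hβ : ∀ θ, β θ ∈ Ioo hm hp)
    (hd : HasDerivAt β (ε * energyRate G g f x₀ a b ((β θ, ε), θ)) θ)
    (hA : 0 < angularRate g f x₀ ε (radius G x₀ a b (β θ) θ) θ) :
    HasDerivAt (fun θ => radius G x₀ a b (β θ) θ)
      (radius G x₀ a b (β θ) θ ^ 2 * (sin θ * g (x₀ + radius G x₀ a b (β θ) θ * cos θ)
        - radius G x₀ a b (β θ) θ * sin θ * cos θ
        - ε * f (x₀ + radius G x₀ a b (β θ) θ * cos θ) * radius G x₀ a b (β θ) θ * sin θ ^ 2) /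
        angularRate g f x₀ ε (radius G x₀ a b (β θ) θ) θ) θ := by
  have hr : DifferentiableAt ℝ (fun θ => radius G x₀ a b (β θ) θ) θ :=
    DifferentiableAt.comp (g := fun p : ℝ × ℝ => radius G x₀ a b p.1 p.2)
      (f := fun θ => (β θ, θ)) θ
      ((H.contDiffAt_radius hG hGc (hβ θ)).differentiableAt one_ne_zero)
      (hd.differentiableAt.prodMk differentiableAt_id)
  obtain ⟨r', hr'⟩ : ∃ r', HasDerivAt (fun θ => radius G x₀ a b (β θ) θ) r' θ := ⟨_, hr.hasDerivAt⟩
  have hrad : ∀ θ, IsRadius G x₀ a b (β θ) θ (radius G x₀ a b (β θ) θ) := fun θ =>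
    H.isRadius_radius hG θ (hβ θ)
  have hE : (fun θ => (radius G x₀ a b (β θ) θ * sin θ) ^ 2 / 2 +
      G (x₀ + radius G x₀ a b (β θ) θ * cos θ)) = β := funext fun θ => (hrad θ).2.2
  have h1 := ((hr'.mul (hasDerivAt_sin θ)).pow 2).div_const 2
  have h2 := (hG (x₀ + radius G x₀ a b (β θ) θ * cos θ)).comp θ
    ((hr'.mul (hasDerivAt_cos θ)).const_add x₀)
  have h3 := h1.add h2
  have h4 := (h3.congr_of_eventuallyEq (EventuallyEq.of_eq hE.symm)).unique hd
  refine hr'.congr_deriv ?_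
  have hA0 := mul_pos (hrad θ).1 (H.ray_deriv_pos (hβ θ) (hrad θ))
  have hr0 := (hrad θ).1
  rw [eq_div_iff hA.ne']
  simp only [energyRate] at h4
  rw [mul_div_assoc', eq_div_iff hA.ne'] at h4
  unfold angularRate at h4 ⊢
  simp only [Pi.mul_apply, Nat.cast_ofNat] at h4
  set r := radius G x₀ a b (β θ) θ
  set gx := g (x₀ + r * cos θ)
  set fx := f (x₀ + r * cos θ)
  have hsc : cos θ ^ 2 = 1 - sin θ ^ 2 := by rw [← sin_sq_add_cos_sq θ]; ring
  refine mul_left_cancel₀ hA0.ne' ?_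
  linear_combination r * h4 + ε * fx * r ^ 5 * sin θ ^ 2 * hsc

end

theorem exists_time_change {q : ℝ → ℝ} {T : ℝ} (hT : 0 < T) (hq : Continuous q)
    (hpos : ∀ θ, 0 < q θ) (hper : Function.Periodic q T) :
    ∃ φ : ℝ → ℝ, (∀ t, HasDerivAt φ (q (φ t))⁻¹ t) ∧
      (∃ S, 0 < S ∧ ∀ t, φ (t + S) = φ t + T) ∧ Function.Surjective φ := by
  set P : ℝ → ℝ := fun x => ∫ s in (0 : ℝ)..x, q s with hP
  have hPd : ∀ x, HasDerivAt P (q x) x := fun x => (hq.integral_hasStrictDerivAt 0 x).hasDerivAt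
  have hi : ∀ x y, IntervalIntegrable q MeasureTheory.volume x y := fun _ _ =>
    hq.intervalIntegrable _ _
  have hPm : StrictMono P := strictMono_of_deriv_pos fun x => by rw [(hPd x).deriv]; exact hpos x
  have hPc : Continuous P := continuous_iff_continuousAt.2 fun x => (hPd x).continuousAt
  have hPs : Function.Surjective P := hPc.surjective
    (hper.tendsto_atTop_intervalIntegral_of_pos' (hi _ _) hpos hT)
    (hper.tendsto_atBot_intervalIntegral_of_pos' (hi _ _) hpos hT)
  set e := hPm.orderIsoOfSurjective P hPs with he
  have hPe : ∀ t, P (e.symm t) = t := fun t => e.apply_symm_apply t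
  have hPT : ∀ x, P (x + T) = P x + P T := fun x => by
    rw [hP]
    dsimp only
    rw [← intervalIntegral.integral_add_adjacent_intervals (hi 0 x) (hi x (x + T)),
      hper.intervalIntegral_add_eq x 0, zero_add]
  refine ⟨e.symm, fun t => ?_, ⟨P T, ?_, fun t => hPm.injective ?_⟩, e.symm.surjective⟩
  · exact HasDerivAt.of_local_left_inverse e.symm.continuous.continuousAt (hPd _) (hpos _).ne'
      (Eventually.of_forall hPe)
  · simpa [hP] using hPm hT
  · rw [hPe, hPT, hPe]

section
variable {G : ℝ → ℝ} {f g : ℝ[X]} {x₀ a b hm hp : ℝ}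

/-- The curve with angular parameter `θ` and energy `β θ`. -/
noncomputable def ovalCurve (G : ℝ → ℝ) (x₀ a b : ℝ) (β : ℝ → ℝ) (θ : ℝ) : ℝ × ℝ :=
  (x₀ + radius G x₀ a b (β θ) θ * cos θ, -(radius G x₀ a b (β θ) θ * sin θ))

theorem ovalCurve_periodic {β : ℝ → ℝ} (hβ : Function.Periodic β (2 * π)) :
    Function.Periodic (ovalCurve G x₀ a b β) (2 * π) := fun θ => by
  simp only [ovalCurve, hβ θ, radius_add_two_pi, cos_add_two_pi, sin_add_two_pi]

theorem IsAnnulus.exists_isPeriodicOrbit (H : IsAnnulus G g.eval x₀ a b hm hp)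
    (hG : ∀ x, HasDerivAt G (g.eval x) x) (hGc : ContDiff ℝ 1 G)
    {β : ℝ → ℝ} {ε : ℝ} (hβp : Function.Periodic β (2 * π))
    (hβ : ∀ θ, β θ ∈ Ioo hm hp)
    (hd : ∀ θ, HasDerivAt β (ε * energyRate G g.eval f.eval x₀ a b ((β θ, ε), θ)) θ)
    (hA : ∀ θ, 0 < angularRate g.eval f.eval x₀ ε (radius G x₀ a b (β θ) θ) θ) :
    IsPeriodicOrbit (lienard f g ε) (range (ovalCurve G x₀ a b β)) := by
  have hr := fun θ => H.hasDerivAt_radius hG hGc hβ (hd θ) (hA θ)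
  have hrad : ∀ θ, IsRadius G x₀ a b (β θ) θ (radius G x₀ a b (β θ) θ) := fun θ =>
    H.isRadius_radius hG θ (hβ θ)
  have hrc : Continuous fun θ => radius G x₀ a b (β θ) θ :=
    continuous_iff_continuousAt.2 fun θ => (hr θ).continuousAt
  have hAc : Continuous fun θ => angularRate g.eval f.eval x₀ ε (radius G x₀ a b (β θ) θ) θ := by
    unfold angularRate
    have := g.continuous
    have := f.continuous
    fun_prop
  have hdc : ∀ θ, HasDerivAt (ovalCurve G x₀ a b β)
      ((radius G x₀ a b (β θ) θ ^ 2 / angularRate g.eval f.eval x₀ ε (radius G x₀ a b (β θ) θ) θ) •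
        lienard f g ε (ovalCurve G x₀ a b β θ)) θ := by
    intro θ
    have h1 := (((hr θ).mul (hasDerivAt_cos θ)).const_add x₀).prodMk
      ((hr θ).mul (hasDerivAt_sin θ)).neg
    refine h1.congr_deriv ?_
    have hsc : cos θ ^ 2 = 1 - sin θ ^ 2 := by rw [← sin_sq_add_cos_sq θ]; ring
    have hA' := (hA θ).ne'
    simp only [lienard, ovalCurve, Prod.smul_mk, smul_eq_mul, Prod.mk.injEq]
    set r := radius G x₀ a b (β θ) θ
    constructor
    · field_simp
      unfold angularRate
      linear_combination (-(r ^ 3 * sin θ)) * hsc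
    · field_simp
      unfold angularRate
      linear_combination (r ^ 3 * sin θ * ε * f.eval (x₀ + r * cos θ) -
        r ^ 2 * g.eval (x₀ + r * cos θ)) * hsc
  obtain ⟨φ, hφ, ⟨S, hS, hφS⟩, hφs⟩ := exists_time_change two_pi_pos
    (q := fun θ => radius G x₀ a b (β θ) θ ^ 2 /
      angularRate g.eval f.eval x₀ ε (radius G x₀ a b (β θ) θ) θ)
    ((hrc.pow 2).div hAc fun θ => (hA θ).ne') (fun θ => div_pos (pow_pos (hrad θ).1 2) (hA θ))
    (fun θ => by
      simp only [angularRate, hβp θ, radius_add_two_pi, cos_add_two_pi, sin_add_two_pi])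
  refine ⟨ovalCurve G x₀ a b β ∘ φ, fun t => ?_, ⟨S, hS, fun t => ?_⟩, ?_, ?_⟩
  · refine ((hdc (φ t)).scomp t (hφ t)).congr_deriv ?_
    rw [smul_smul, inv_mul_cancel₀, one_smul]
    · rfl
    · exact (div_pos (pow_pos (hrad _).1 2) (hA _)).ne'
  · simp only [Function.comp, hφS]
    exact ovalCurve_periodic hβp _
  · obtain ⟨t₁, ht₁⟩ := hφs 0
    obtain ⟨t₂, ht₂⟩ := hφs π
    refine ⟨t₁, t₂, fun heq => ?_⟩
    have := congrArg Prod.fst heq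
    simp only [Function.comp, ht₁, ht₂, ovalCurve, cos_zero, cos_pi] at this
    linarith [(hrad 0).1, (hrad π).1]
  · rw [hφs.range_comp]

end

section
variable {G : ℝ → ℝ} {f g : ℝ[X]} {x₀ a b hm hp : ℝ}

theorem exists_polar (u v : ℝ) :
    ∃ θ, u = √(u ^ 2 + v ^ 2) * cos θ ∧ v = √(u ^ 2 + v ^ 2) * sin θ := by
  have hn : ‖(⟨u, v⟩ : ℂ)‖ = √(u ^ 2 + v ^ 2) := by
    rw [Complex.norm_def, Complex.normSq_mk, sq, sq]
  refine ⟨Complex.arg ⟨u, v⟩, ?_, ?_⟩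
  · rw [← hn, Complex.norm_mul_cos_arg]
  · rw [← hn, Complex.norm_mul_sin_arg]

theorem IsAnnulus.exists_angle (H : IsAnnulus G g.eval x₀ a b hm hp)
    {ε : ℝ} {γ : ℝ → ℝ × ℝ}
    (hγ : ∀ t, HasDerivAt γ (lienard f g ε (γ t)) t) (h1 : ∀ t, (γ t).1 ∈ Ioo a b)
    (h2 : ∀ t, (γ t).2 ^ 2 / 2 + G (γ t).1 ∈ Ioo hm hp) :
    ∃ φ ρ : ℝ → ℝ, ∀ t, IsRadius G x₀ a b ((γ t).2 ^ 2 / 2 + G (γ t).1) (φ t) (ρ t) ∧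
      γ t = (x₀ + ρ t * cos (φ t), -(ρ t * sin (φ t))) ∧
      HasDerivAt φ (angularRate g.eval f.eval x₀ ε (ρ t) (φ t) / ρ t ^ 2) t := by
  set u : ℝ → ℝ := fun t => (γ t).1 - x₀ with hu
  set v : ℝ → ℝ := fun t => -(γ t).2 with hv
  have hud : ∀ t, HasDerivAt u (-v t) t := fun t => by
    have := ((hasFDerivAt_fst (𝕜 := ℝ) (p := γ t)).comp_hasDerivAt t (hγ t)).sub_const x₀
    simpa [hu, hv, lienard] using this
  have hvd : ∀ t, HasDerivAt v (g.eval (u t + x₀) - ε * f.eval (u t + x₀) * v t) t := fun t => by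
    have := ((hasFDerivAt_snd (𝕜 := ℝ) (p := γ t)).comp_hasDerivAt t (hγ t)).neg
    refine this.congr_deriv ?_
    simp [hu, hv, lienard]
    ring
  have hpos : ∀ t, 0 < u t ^ 2 + v t ^ 2 := fun t => by
    by_contra! hcon
    have e1 : u t = 0 := by nlinarith [sq_nonneg (u t), sq_nonneg (v t)]
    have e2 : v t = 0 := by nlinarith [sq_nonneg (u t), sq_nonneg (v t)]
    have e3 : (γ t).1 = x₀ := by linarith [e1]
    have e4 : (γ t).2 = 0 := by linarith [e2]
    have := (h2 t).1
    rw [e3, e4] at this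
    linarith [H.low]
  set ρ : ℝ → ℝ := fun t => √(u t ^ 2 + v t ^ 2) with hρ
  have hρ0 : ∀ t, 0 < ρ t := fun t => sqrt_pos.2 (hpos t)
  have hρ2 : ∀ t, ρ t ^ 2 = u t ^ 2 + v t ^ 2 := fun t => sq_sqrt (hpos t).le
  set V : ℝ → ℝ := fun t => g.eval (u t + x₀) - ε * f.eval (u t + x₀) * v t with hV
  set w : ℝ → ℝ := fun t => (u t * V t + v t * v t) / ρ t ^ 2 with hw
  have huc : Continuous u := continuous_iff_continuousAt.2 fun t => (hud t).continuousAt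
  have hvc : Continuous v := continuous_iff_continuousAt.2 fun t => (hvd t).continuousAt
  have hVc : Continuous V := by
    have := g.continuous
    have := f.continuous
    simp only [hV]
    fun_prop
  have hρc : Continuous ρ := by simp only [hρ]; fun_prop
  have hwc : Continuous w := ((huc.mul hVc).add (hvc.mul hvc)).div (hρc.pow 2)
    fun t => (pow_pos (hρ0 t) 2).ne'
  obtain ⟨θ₀, hθu, hθv⟩ : ∃ θ₀, u 0 = ρ 0 * cos θ₀ ∧ v 0 = ρ 0 * sin θ₀ := exists_polar (u 0) (v 0)
  set φ : ℝ → ℝ := fun t => θ₀ + ∫ s in (0 : ℝ)..t, w s with hφ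
  have hφd : ∀ t, HasDerivAt φ (w t) t := fun t =>
    (hwc.integral_hasStrictDerivAt 0 t).hasDerivAt.const_add θ₀
  have hρd : ∀ t, HasDerivAt ρ ((u t * (-v t) + v t * V t) / ρ t) t := fun t => by
    have := (((hud t).pow 2).add ((hvd t).pow 2)).sqrt (hpos t).ne'
    refine this.congr_deriv ?_
    change (_ / (2 * ρ t) : ℝ) = _
    have := (hρ0 t).ne'
    field_simp
    simp only [hV]
    push_cast
    ring
  have hp0 : ∀ t, HasDerivAt (fun t => (u t * cos (φ t) + v t * sin (φ t)) / ρ t) 0 t := fun t => by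
    have := (((hud t).mul (hφd t).cos).add ((hvd t).mul (hφd t).sin)).div (hρd t) (hρ0 t).ne'
    refine this.congr_deriv ?_
    have h0 := (hρ0 t).ne'
    rw [div_eq_zero_iff]
    left
    change (-v t * cos (φ t) + u t * (-sin (φ t) * w t) +
      (V t * sin (φ t) + v t * (cos (φ t) * w t))) *
      ρ t - (u t * cos (φ t) + v t * sin (φ t)) * ((u t * (-v t) + v t * V t) / ρ t) = 0
    simp only [hw]
    field_simp
    rw [hρ2]
    ring
  have hq0 : ∀ t, HasDerivAt (fun t => (u t * sin (φ t) - v t * cos (φ t)) / ρ t) 0 t := fun t => by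
    have := (((hud t).mul (hφd t).sin).sub ((hvd t).mul (hφd t).cos)).div (hρd t) (hρ0 t).ne'
    refine this.congr_deriv ?_
    have h0 := (hρ0 t).ne'
    rw [div_eq_zero_iff]
    left
    change (-v t * sin (φ t) + u t * (cos (φ t) * w t) -
      (V t * cos (φ t) + v t * (-sin (φ t) * w t))) *
      ρ t - (u t * sin (φ t) - v t * cos (φ t)) * ((u t * (-v t) + v t * V t) / ρ t) = 0
    simp only [hw]
    field_simp
    rw [hρ2]
    ring
  have hφ0 : φ 0 = θ₀ := by simp [hφ]
  have hsc : ∀ t, sin (φ t) ^ 2 + cos (φ t) ^ 2 = 1 := fun t => sin_sq_add_cos_sq _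
  have hp1 : ∀ t, u t * cos (φ t) + v t * sin (φ t) = ρ t := fun t => by
    have := is_const_of_deriv_eq_zero (fun t => (hp0 t).differentiableAt)
      (fun t => (hp0 t).deriv) t 0
    have e : (u 0 * cos (φ 0) + v 0 * sin (φ 0)) / ρ 0 = 1 := by
      rw [div_eq_one_iff_eq (hρ0 0).ne', hφ0]
      linear_combination cos θ₀ * hθu + sin θ₀ * hθv + ρ 0 * sin_sq_add_cos_sq θ₀
    rw [e, div_eq_one_iff_eq (hρ0 t).ne'] at this
    exact this
  have hq1 : ∀ t, u t * sin (φ t) - v t * cos (φ t) = 0 := fun t => by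
    have := is_const_of_deriv_eq_zero (fun t => (hq0 t).differentiableAt)
      (fun t => (hq0 t).deriv) t 0
    have e : (u 0 * sin (φ 0) - v 0 * cos (φ 0)) / ρ 0 = 0 := by
      rw [div_eq_zero_iff, hφ0]
      left
      linear_combination sin θ₀ * hθu - cos θ₀ * hθv
    rw [e, div_eq_zero_iff] at this
    exact this.resolve_right (hρ0 t).ne'
  have hu' : ∀ t, u t = ρ t * cos (φ t) := fun t => by
    linear_combination cos (φ t) * hp1 t + sin (φ t) * hq1 t - u t * hsc t
  have hv' : ∀ t, v t = ρ t * sin (φ t) := fun t => by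
    linear_combination sin (φ t) * hp1 t - cos (φ t) * hq1 t - v t * hsc t
  have hx : ∀ t, (γ t).1 = x₀ + ρ t * cos (φ t) := fun t => by rw [← hu']; simp [hu]
  have hy : ∀ t, (γ t).2 = -(ρ t * sin (φ t)) := fun t => by rw [← hv']; simp [hv]
  refine ⟨φ, ρ, fun t => ⟨⟨hρ0 t, ?_, ?_⟩, Prod.ext (hx t) (hy t), ?_⟩⟩
  · rw [← hx]; exact h1 t
  · rw [hx, hy, neg_sq]
  · refine (hφd t).congr_deriv ?_
    simp only [hw, hV, angularRate]
    rw [← hu', ← hv', add_comm x₀]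
    congr 1
    ring

end

section
variable {G : ℝ → ℝ} {f g : ℝ[X]} {x₀ a b hm hp : ℝ}

theorem eq_of_energy_curve (H : IsAnnulus G g.eval x₀ a b hm hp)
    (hG : ∀ x, HasDerivAt G (g.eval x) x) {β : ℝ → ℝ} {p : ℝ × ℝ} {ρ θ : ℝ}
    (hβ : p.2 ^ 2 / 2 + G p.1 = β θ) (hJ : β θ ∈ Ioo hm hp)
    (hr : IsRadius G x₀ a b (p.2 ^ 2 / 2 + G p.1) θ ρ)
    (hp : p = (x₀ + ρ * cos θ, -(ρ * sin θ))) : p = ovalCurve G x₀ a b β θ := by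
  rw [hβ] at hr
  rw [ovalCurve, H.radius_eq hG hJ hr, hp]

/-- A simple zero of the averaged energy rate produces a limit cycle. -/
theorem IsAnnulus.exists_isLimitCycle_of_average (H : IsAnnulus G g.eval x₀ a b hm hp)
    (hG : ∀ x, HasDerivAt G (g.eval x) x) (hGc : ContDiff ℝ 1 G) {h₀ η : ℝ}
    (hh₀ : h₀ ∈ Ioo hm hp)
    (hz : ∫ θ in (0 : ℝ)..2 * π, energyRate G g.eval f.eval x₀ a b ((h₀, 0), θ) = 0)
    (hd : ∫ θ in (0 : ℝ)..2 * π, partialFst (energyRate G g.eval f.eval x₀ a b) ((h₀, 0), θ) ≠ 0)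
    (hη : 0 < η) :
    ∃ ε₀ > 0, ∀ ε, 0 < ε → ε ≤ ε₀ → ∃ Γ, IsLimitCycle (lienard f g ε) Γ ∧
      Γ ⊆ {p | p.1 ∈ Ioo a b ∧ |p.2 ^ 2 / 2 + G p.1 - h₀| < η} := by
  have hgc : ContDiff ℝ 1 g.eval := by simpa using Polynomial.contDiff_aeval (𝕜 := ℝ) g 1
  have hfc : ContDiff ℝ 1 f.eval := by simpa using Polynomial.contDiff_aeval (𝕜 := ℝ) f 1
  set R := energyRate G g.eval f.eval x₀ a b with hR
  have hRc : ∀ θ, ContDiffAt ℝ 1 R ((h₀, 0), θ) := fun θ =>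
    H.contDiffAt_energyRate hG hGc hgc hfc θ hh₀
  have hper : ∀ p θ, R (p, θ + 2 * π) = R (p, θ) := energyRate_periodic G g.eval f.eval x₀ a b
  have hev := (H.eventually_angularRate_pos hG hGc hgc hfc hh₀).and
    (continuousAt_fst.eventually_mem (isOpen_Ioo.mem_nhds hh₀) :
      ∀ᶠ p : ℝ × ℝ in 𝓝 (h₀, 0), p.1 ∈ Ioo hm hp)
  obtain ⟨η₁, hη₁, hball⟩ := Metric.eventually_nhds_iff_ball.1 hev
  obtain ⟨δ, hδ, hex⟩ := exists_periodic_solution_of_simple_zero two_pi_pos hRc hper hz rfl hd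
  obtain ⟨η', hη', hη'le, ε₁, hε₁, hsol⟩ := hex (min η (η₁ / 2)) (by positivity)
  refine ⟨min ε₁ (η₁ / 2), by positivity, fun ε hε hεle => ?_⟩
  obtain ⟨⟨β, hβp, hβ1, hβd⟩, happ⟩ := hsol ε hε (hεle.trans (min_le_left _ _))
  have hball' : ∀ h, |h - h₀| < η' →
      (∀ θ, 0 < angularRate g.eval f.eval x₀ ε (radius G x₀ a b h θ) θ) ∧ h ∈ Ioo hm hp := by
    intro h hh
    refine hball (h, ε) ?_
    rw [Metric.mem_ball, Prod.dist_eq, max_lt_iff, Real.dist_eq, Real.dist_eq, sub_zero,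
      abs_of_pos hε]
    have h1 := hη'le.trans (min_le_right _ _)
    have h2 := hεle.trans (min_le_right _ _)
    constructor <;> linarith
  have hβJ : ∀ θ, β θ ∈ Ioo hm hp := fun θ => (hball' _ (hβ1 θ)).2
  have hrad : ∀ θ, IsRadius G x₀ a b (β θ) θ (radius G x₀ a b (β θ) θ) := fun θ =>
    H.isRadius_radius hG θ (hβJ θ)
  have hΓ : range (ovalCurve G x₀ a b β) ⊆
      {p | p.1 ∈ Ioo a b ∧ |p.2 ^ 2 / 2 + G p.1 - h₀| < η'} := by
    rintro _ ⟨θ, rfl⟩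
    refine ⟨(hrad θ).2.1, ?_⟩
    have := hβ1 θ
    rw [← (hrad θ).2.2] at this
    simpa only [ovalCurve, neg_sq] using this
  refine ⟨range (ovalCurve G x₀ a b β), ⟨H.exists_isPeriodicOrbit hG hGc hβp hβJ hβd
    fun θ => (hball' _ (hβ1 θ)).1 θ, _, ?_, hΓ, ?_⟩,
    hΓ.trans fun p hp => ⟨hp.1, hp.2.trans_le (hη'le.trans (min_le_left _ _))⟩⟩
  · have hGcont := hGc.continuous
    exact (isOpen_Ioo.preimage continuous_fst).inter
      (isOpen_lt (((continuous_snd.pow 2).div_const 2).add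
        (hGcont.comp continuous_fst) |>.sub continuous_const).abs continuous_const)
  · rintro Γ' ⟨γ, hγ, ⟨S, hS, hγS⟩, -, rfl⟩ hU
    have hU' : ∀ t, (γ t).1 ∈ Ioo a b ∧ |(γ t).2 ^ 2 / 2 + G (γ t).1 - h₀| < η' := fun t =>
      hU (mem_range_self t)
    have hJ := fun t => (hball' _ (hU' t).2).2
    obtain ⟨φ, ρ, hφρ⟩ := H.exists_angle hγ (fun t => (hU' t).1) hJ
    set h : ℝ → ℝ := fun t => (γ t).2 ^ 2 / 2 + G (γ t).1 with hh
    have hρr : ∀ t, ρ t = radius G x₀ a b (h t) (φ t) := fun t =>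
      (H.radius_eq hG (hJ t) (hφρ t).1).symm
    set w : ℝ → ℝ := fun t => angularRate g.eval f.eval x₀ ε (ρ t) (φ t) / ρ t ^ 2 with hw
    have hApos : ∀ t, 0 < angularRate g.eval f.eval x₀ ε (ρ t) (φ t) := fun t => by
      rw [hρr]; exact (hball' _ (hU' t).2).1 _
    have hwpos : ∀ t, 0 < w t := fun t => div_pos (hApos t) (pow_pos (hφρ t).1.1 2)
    have hφd : ∀ t, HasDerivAt φ (w t) t := fun t => (hφρ t).2.2
    have hhd : ∀ t, HasDerivAt h (ε * R ((h t, ε), φ t) * w t) t := fun t => by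
      have d1 := (hasFDerivAt_fst (𝕜 := ℝ) (p := γ t)).comp_hasDerivAt t (hγ t)
      have d2 := (hasFDerivAt_snd (𝕜 := ℝ) (p := γ t)).comp_hasDerivAt t (hγ t)
      have d3 := ((d2.pow 2).div_const 2).add ((hG (γ t).1).comp t d1)
      refine d3.congr_deriv ?_
      have hρ0 := (hφρ t).1.1.ne'
      have hA0 := (hApos t).ne'
      have e1 : (γ t).1 = x₀ + ρ t * cos (φ t) := congrArg Prod.fst (hφρ t).2.1
      have e2 : (γ t).2 = -(ρ t * sin (φ t)) := congrArg Prod.snd (hφρ t).2.1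
      simp only [hR, energyRate, hw, ← hρr]
      simp only [Function.comp, lienard, ContinuousLinearMap.coe_fst',
        ContinuousLinearMap.coe_snd', e1, e2]
      field_simp
      push_cast
      ring
    obtain ⟨k, hk⟩ : ∃ k : ℤ, φ S - φ 0 = 2 * π * k := by
      have e0 : γ S = γ 0 := by simpa using hγS 0
      have e1 : (γ S).2 ^ 2 / 2 + G (γ S).1 = (γ 0).2 ^ 2 / 2 + G (γ 0).1 := by rw [e0]
      have hS0 := (hφρ S).2.1.symm.trans (e0.trans (hφρ 0).2.1)
      have c1 := congrArg Prod.fst hS0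
      have c2 := congrArg Prod.snd hS0
      simp only at c1 c2
      have hr2 : ρ S ^ 2 = ρ 0 ^ 2 := by
        have s1 := sin_sq_add_cos_sq (φ S)
        have s2 := sin_sq_add_cos_sq (φ 0)
        have c3 : ρ S * cos (φ S) = ρ 0 * cos (φ 0) := by linarith
        have c4 : ρ S * sin (φ S) = ρ 0 * sin (φ 0) := by linarith
        calc ρ S ^ 2 = (ρ S * cos (φ S)) ^ 2 + (ρ S * sin (φ S)) ^ 2 := by
              linear_combination -ρ S ^ 2 * s1
          _ = ρ 0 ^ 2 := by rw [c3, c4]; linear_combination ρ 0 ^ 2 * s2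
      have hr : ρ S = ρ 0 :=
        (pow_left_inj₀ (hφρ S).1.1.le (hφρ 0).1.1.le two_ne_zero).1 hr2
      rw [hr] at c1 c2
      have h0 := (hφρ 0).1.1.ne'
      refine Real.Angle.angle_eq_iff_two_pi_dvd_sub.1 (Real.Angle.cos_sin_inj ?_ ?_)
      · exact mul_left_cancel₀ h0 (by linarith)
      · exact mul_left_cancel₀ h0 (by linarith)
    have hφm : StrictMono φ := strictMono_of_deriv_pos fun t => by rw [(hφd t).deriv]; exact hwpos t
    have hkpos : 0 < k := by
      have h1 := hφm hS
      have h2 : 0 < 2 * π * (k : ℝ) := by linarith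
      exact_mod_cast pos_of_mul_pos_right h2 two_pi_pos.le
    have heq : ∀ t, h t = β (φ t) := eq_periodic_solution_of_linear_approx
      (F := fun h θ => R ((h, ε), θ)) hε (continuous_partialFst_slice hRc) two_pi_pos
      (fun θ => partialFst_periodic hper _ θ) hδ hβp hβd hφd hwpos hhd
      (fun t => happ _ _ _ (hU' t).2.le (hβ1 _).le) hkpos
      (by simp only [hh]; rw [show γ S = γ 0 by simpa using hγS 0]) (by linarith)
    have hcurve : ∀ t, γ t = ovalCurve G x₀ a b β (φ t) := fun t =>
      eq_of_energy_curve H hG (heq t) (hβJ _) (hφρ t).1 (hφρ t).2.1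
    refine Subset.antisymm ?_ ?_
    · rintro _ ⟨t, rfl⟩
      exact ⟨φ t, (hcurve t).symm⟩
    · rintro _ ⟨θ, rfl⟩
      obtain ⟨θ', hθ', he⟩ := (ovalCurve_periodic (G := G) (x₀ := x₀) (a := a) (b := b)
        hβp).exists_mem_Ico two_pi_pos θ (φ 0)
      have hle : φ 0 + 2 * π ≤ φ S := by
        have : (1 : ℝ) ≤ k := by exact_mod_cast hkpos
        have := mul_le_mul_of_nonneg_left this two_pi_pos.le
        linarith
      have hφc : ContinuousOn φ (Icc 0 S) := fun t _ => (hφd t).continuousAt.continuousWithinAt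
      obtain ⟨t, -, ht⟩ := intermediate_value_Icc hS.le hφc
        ⟨hθ'.1, hθ'.2.le.trans hle⟩
      exact ⟨t, by rw [hcurve, ht, he]⟩

end

/-- The first Melnikov function of the oval of level `h` over `(a, b)`. -/
noncomputable def melnikov (G f : ℝ → ℝ) (a b h : ℝ) : ℝ := ∫ x in a..b, f x * √(2 * (h - G x))

section
variable {G f g : ℝ → ℝ} {x₀ a b hm hp : ℝ}

theorem IsAnnulus.hasDerivAt_abscissa (H : IsAnnulus G g x₀ a b hm hp)
    (hG : ∀ x, HasDerivAt G (g x) x) (hGc : ContDiff ℝ 1 G) {h : ℝ} (hh : h ∈ Ioo hm hp) (θ : ℝ) :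
    HasDerivAt (fun θ => x₀ + radius G x₀ a b h θ * cos θ)
      (-(radius G x₀ a b h θ ^ 3 * sin θ) /
        angularRate g (fun _ => 0) x₀ 0 (radius G x₀ a b h θ) θ) θ := by
  have hA := H.angularRate_pos (f := fun _ => 0) hG θ hh
  have hr := H.hasDerivAt_radius (f := fun _ => 0) (β := fun _ => h) (ε := 0) hG hGc (fun _ => hh)
    (by simpa using hasDerivAt_const θ h) hA
  refine ((hr.mul (hasDerivAt_cos θ)).const_add x₀).congr_deriv ?_
  have hA' := hA.ne'
  field_simp
  simp only [angularRate]
  linear_combination -(radius G x₀ a b h θ ^ 3 * sin θ) * sin_sq_add_cos_sq θ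

theorem IsAnnulus.integral_energyRate (H : IsAnnulus G g x₀ a b hm hp)
    (hG : ∀ x, HasDerivAt G (g x) x) (hGc : ContDiff ℝ 1 G) (hg : Continuous g)
    (hf : Continuous f) {h : ℝ} (hh : h ∈ Ioo hm hp) :
    ∫ θ in (0 : ℝ)..2 * π, energyRate G g f x₀ a b ((h, 0), θ) = -2 * melnikov G f a b h := by
  have hr := fun θ => H.isRadius_radius hG θ hh
  set r : ℝ → ℝ := fun θ => radius G x₀ a b h θ with hrdef
  set A : ℝ → ℝ := fun θ => angularRate g (fun _ => 0) x₀ 0 (r θ) θ with hAdef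
  have hA : ∀ θ, 0 < A θ := fun θ => H.angularRate_pos hG θ hh
  set X : ℝ → ℝ := fun θ => x₀ + r θ * cos θ with hX
  set X' : ℝ → ℝ := fun θ => -(r θ ^ 3 * sin θ) / A θ with hX'
  have hXd : ∀ θ, HasDerivAt X (X' θ) θ := H.hasDerivAt_abscissa hG hGc hh
  have hrc : Continuous r := continuous_iff_continuousAt.2 fun θ =>
    (H.contDiffAt_radius hG hGc (θ := θ) hh).continuousAt.comp
      (f := fun θ : ℝ => (h, θ)) (by fun_prop)
  have hAc : Continuous A := by
    have := hG
    simp only [hAdef, angularRate]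
    fun_prop
  have hX'c : Continuous X' := Continuous.div (by fun_prop) hAc fun θ => (hA θ).ne'
  have hGcont : Continuous G := hGc.continuous
  set φ : ℝ → ℝ := fun x => f x * √(2 * (h - G x)) with hφ
  have hφc : Continuous φ := by fun_prop
  have hsq : ∀ θ, 2 * (h - G (X θ)) = (r θ * sin θ) ^ 2 := fun θ => by
    have := (hr θ).2.2
    simp only [hX]
    linarith
  have hE : ∀ θ, energyRate G g f x₀ a b ((h, 0), θ) =
      -(f (X θ) * (r θ * sin θ) ^ 2 * r θ ^ 2) / A θ :=
    fun θ => by simp [energyRate, hAdef, hX, hrdef, angularRate]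
  have hEc : Continuous fun θ => energyRate G g f x₀ a b ((h, 0), θ) := by
    have hXc : Continuous X := by fun_prop
    simp only [hE]
    exact Continuous.div (by fun_prop) hAc fun θ => (hA θ).ne'
  have h1 : ∫ θ in (0 : ℝ)..π, energyRate G g f x₀ a b ((h, 0), θ) = ∫ x in X 0..X π, φ x := by
    rw [← intervalIntegral.integral_comp_mul_deriv (fun θ _ => hXd θ) hX'c.continuousOn hφc]
    refine intervalIntegral.integral_congr fun θ hθ => ?_
    rw [uIcc_of_le pi_pos.le] at hθ
    have hs := sin_nonneg_of_mem_Icc hθ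
    simp only [Function.comp, hφ, hE]
    rw [hsq, sqrt_sq (mul_nonneg (hr θ).1.le hs)]
    simp only [hX']
    ring
  have h2 : ∫ θ in π..2 * π, energyRate G g f x₀ a b ((h, 0), θ) = -∫ x in X π..X 0, φ x := by
    have hX2 : X (2 * π) = X 0 := by
      have := radius_add_two_pi G x₀ a b h 0
      rw [zero_add] at this
      simp only [hX, hrdef, this, cos_two_pi, cos_zero]
    rw [← hX2, ← intervalIntegral.integral_comp_mul_deriv (fun θ _ => hXd θ) hX'c.continuousOn hφc,
      ← intervalIntegral.integral_neg]
    refine intervalIntegral.integral_congr fun θ hθ => ?_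
    rw [uIcc_of_le (by linarith [pi_pos])] at hθ
    have hs : 0 ≤ -sin θ := by
      rw [← sin_sub_pi]
      exact sin_nonneg_of_mem_Icc ⟨by linarith [hθ.1], by linarith [hθ.2]⟩
    simp only [Function.comp, hφ, hE]
    rw [hsq, ← neg_sq, sqrt_sq (by rw [← mul_neg]; exact mul_nonneg (hr θ).1.le hs)]
    simp only [hX']
    ring
  have hle : ∀ x ∈ Icc a b, x ∉ Ioo (X π) (X 0) → φ x = 0 := by
    intro x hx hx'
    have hGx : h ≤ G x := by
      rcases hx.1.eq_or_lt with rfl | hxa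
      · exact hh.2.le.trans H.high_left
      rcases hx.2.eq_or_lt with rfl | hxb
      · exact hh.2.le.trans H.high_right
      rcases le_or_gt x (X π) with hc | hc
      · have := H.le_energy hG hh (hr π) (ρ' := x₀ - x)
          (by simp only [hX, cos_pi] at hc; change r π ≤ _; linarith)
          (by simpa using ⟨hxa, hxb⟩)
        simpa using this
      · have hc' : X 0 ≤ x := not_lt.1 fun h' => hx' ⟨hc, h'⟩
        have := H.le_energy hG hh (hr 0) (ρ' := x - x₀)
          (by simp only [hX, cos_zero] at hc'; change r 0 ≤ _; linarith)
          (by simpa using ⟨hxa, hxb⟩)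
        simpa using this
    simp only [hφ]
    rw [sqrt_eq_zero_of_nonpos (by linarith), mul_zero]
  have hπ : X π ∈ Ioo a b := (hr π).2.1
  have h0 : X 0 ∈ Ioo a b := (hr 0).2.1
  have hπ0 : X π < X 0 := by
    have := (hr 0).1
    have := (hr π).1
    simp only [hX, cos_zero, cos_pi, hrdef]
    linarith
  have hm1 : ∫ x in a..X π, φ x = 0 := by
    rw [intervalIntegral.integral_congr (g := fun _ => 0), intervalIntegral.integral_zero]
    intro x hx
    rw [uIcc_of_le hπ.1.le] at hx
    exact hle x ⟨hx.1, hx.2.trans hπ.2.le⟩ fun h' => h'.1.not_ge hx.2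
  have hm2 : ∫ x in X 0..b, φ x = 0 := by
    rw [intervalIntegral.integral_congr (g := fun _ => 0), intervalIntegral.integral_zero]
    intro x hx
    rw [uIcc_of_le h0.2.le] at hx
    exact hle x ⟨h0.1.le.trans hx.1, hx.2⟩ fun h' => h'.2.not_ge hx.1
  have hi := fun u v : ℝ => hφc.intervalIntegrable (μ := MeasureTheory.volume) u v
  have hm : melnikov G f a b h = ∫ x in X π..X 0, φ x := by
    rw [melnikov, ← intervalIntegral.integral_add_adjacent_intervals (hi a (X π)) (hi (X π) b),
      ← intervalIntegral.integral_add_adjacent_intervals (hi (X π) (X 0)) (hi (X 0) b), hm1, hm2]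
    ring
  rw [← intervalIntegral.integral_add_adjacent_intervals (hEc.intervalIntegrable 0 π)
    (hEc.intervalIntegrable π (2 * π)), h1, h2, hm, intervalIntegral.integral_symm (X π)]
  ring

theorem IsAnnulus.hasDerivAt_melnikov (H : IsAnnulus G g x₀ a b hm hp)
    (hG : ∀ x, HasDerivAt G (g x) x) (hGc : ContDiff ℝ 1 G) (hg : ContDiff ℝ 1 g)
    (hf : ContDiff ℝ 1 f) {h : ℝ} (hh : h ∈ Ioo hm hp) :
    HasDerivAt (melnikov G f a b)
      (-(∫ θ in (0 : ℝ)..2 * π, partialFst (energyRate G g f x₀ a b) ((h, 0), θ)) / 2) h := by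
  have := hasDerivAt_average two_pi_pos (fun θ => H.contDiffAt_energyRate hG hGc hg hf θ hh)
    (energyRate_periodic G g f x₀ a b)
  refine (this.neg.div_const 2).congr_of_eventuallyEq ?_
  filter_upwards [isOpen_Ioo.mem_nhds hh] with k hk
  simp only [Pi.neg_apply]
  rw [H.integral_energyRate hG hGc hg.continuous hf.continuous hk]
  ring

end

/-- A simple zero of the Melnikov function produces a limit cycle. -/
theorem IsAnnulus.exists_isLimitCycle {G : ℝ → ℝ} {f g : ℝ[X]} {x₀ a b hm hp : ℝ}
    (H : IsAnnulus G g.eval x₀ a b hm hp)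
    (hG : ∀ x, HasDerivAt G (g.eval x) x) (hGc : ContDiff ℝ 1 G) {h₀ η : ℝ}
    (hh₀ : h₀ ∈ Ioo hm hp) (hz : melnikov G f.eval a b h₀ = 0)
    (hd : deriv (melnikov G f.eval a b) h₀ ≠ 0) (hη : 0 < η) :
    ∃ ε₀ > 0, ∀ ε, 0 < ε → ε ≤ ε₀ → ∃ Γ, IsLimitCycle (lienard f g ε) Γ ∧
      Γ ⊆ {p | p.1 ∈ Ioo a b ∧ |p.2 ^ 2 / 2 + G p.1 - h₀| < η} := by
  have hgc : ContDiff ℝ 1 g.eval := by simpa using Polynomial.contDiff_aeval (𝕜 := ℝ) g 1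
  have hfc : ContDiff ℝ 1 f.eval := by simpa using Polynomial.contDiff_aeval (𝕜 := ℝ) f 1
  refine H.exists_isLimitCycle_of_average hG hGc hh₀ ?_ ?_ hη
  · rw [H.integral_energyRate hG hGc hgc.continuous hfc.continuous hh₀, hz, mul_zero]
  · intro h
    rw [(H.hasDerivAt_melnikov hG hGc hgc hfc hh₀).deriv, h] at hd
    simp at hd

theorem IsAnnulus.melnikov_one_pos {G g : ℝ → ℝ} {x₀ a b hm hp h : ℝ}
    (H : IsAnnulus G g x₀ a b hm hp) (hG : Continuous G) (hh : h ∈ Ioo hm hp) :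
    0 < melnikov G (fun _ => 1) a b h := by
  refine intervalIntegral.integral_pos (H.left_lt.trans H.lt_right)
    (Continuous.continuousOn (by fun_prop)) (fun x _ => by positivity)
    ⟨x₀, ⟨H.left_lt.le, H.lt_right.le⟩, ?_⟩
  rw [one_mul, sqrt_pos]
  linarith [H.low, hh.1]

theorem melnikov_add_const_mul {G f₁ f₂ : ℝ → ℝ} (hG : Continuous G) (h₁ : Continuous f₁)
    (h₂ : Continuous f₂) (c a b h : ℝ) :
    melnikov G (fun x => f₁ x + c * f₂ x) a b h =
      melnikov G f₁ a b h + c * melnikov G f₂ a b h := by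
  simp only [melnikov]
  rw [← intervalIntegral.integral_const_mul, ← intervalIntegral.integral_add]
  · exact intervalIntegral.integral_congr fun x _ => by ring
  · exact Continuous.intervalIntegrable (by fun_prop) _ _
  · exact Continuous.intervalIntegrable (by fun_prop) _ _

/-- A sign change becomes a simple zero under almost every small perturbation (Sard). -/
theorem exists_simple_zero_of_sign_change {M I : ℝ → ℝ} {α β : ℝ} (hαβ : α < β)
    (hM : ∀ h ∈ Icc α β, DifferentiableAt ℝ M h) (hI : ∀ h ∈ Icc α β, DifferentiableAt ℝ I h)
    (hpos : ∀ h ∈ Icc α β, 0 < I h) (hs : M α * M β < 0) :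
    ∀ᶠ δ in 𝓝 0 ⊓ MeasureTheory.ae MeasureTheory.volume, ∃ h ∈ Ioo α β, M h + δ * I h = 0 ∧
      deriv (fun h => M h + δ * I h) h ≠ 0 := by
  set w : ℝ → ℝ := fun h => -M h / I h with hw
  have hwd : ∀ h ∈ Icc α β, DifferentiableAt ℝ w h := fun h hh =>
    (hM h hh).neg.div (hI h hh) (hpos h hh).ne'
  have hnull : MeasureTheory.volume (w '' {h ∈ Icc α β | deriv w h = 0}) = 0 := by
    refine MeasureTheory.addHaar_image_eq_zero_of_det_fderivWithin_eq_zero (f' := fun _ => 0) _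
      (fun h hh => ?_) fun h _ => by simp
    have h1 := (hwd h hh.1).hasDerivAt
    rw [hh.2] at h1
    have h2 := h1.hasFDerivAt
    rw [ContinuousLinearMap.toSpanSingleton_zero] at h2
    exact h2.hasFDerivWithinAt
  have hae : ∀ᶠ δ in 𝓝 (0 : ℝ) ⊓ MeasureTheory.ae MeasureTheory.volume,
      δ ∉ w '' {h ∈ Icc α β | deriv w h = 0} :=
    (MeasureTheory.measure_eq_zero_iff_ae_notMem.1 hnull).filter_mono inf_le_right
  have hnear : ∀ᶠ δ in 𝓝 (0 : ℝ) ⊓ MeasureTheory.ae MeasureTheory.volume,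
      (M α + δ * I α) * (M β + δ * I β) < 0 := by
    refine Eventually.filter_mono inf_le_left ?_
    have : ContinuousAt (fun δ : ℝ => (M α + δ * I α) * (M β + δ * I β)) 0 := by fun_prop
    exact this.eventually (gt_mem_nhds (by simpa using hs))
  filter_upwards [hae, hnear] with δ h1 h2
  have hcont : ContinuousOn (fun h => M h + δ * I h) (Icc α β) := fun h hh =>
    ((hM h hh).continuousAt.add ((hI h hh).continuousAt.const_mul δ)).continuousWithinAt
  obtain ⟨h, hh, hz⟩ : ∃ h ∈ Ioo α β, M h + δ * I h = 0 := by
    rcases mul_neg_iff.1 h2 with ⟨h3, h4⟩ | ⟨h3, h4⟩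
    · exact intermediate_value_Ioo' hαβ.le hcont ⟨h4, h3⟩
    · exact intermediate_value_Ioo hαβ.le hcont ⟨h3, h4⟩
  refine ⟨h, hh, hz, fun hd => h1 ⟨h, ⟨Ioo_subset_Icc_self hh, ?_⟩, ?_⟩⟩
  · have hh' := Ioo_subset_Icc_self hh
    have d1 := (hM h hh').hasDerivAt
    have d2 := (hI h hh').hasDerivAt
    have d3 : HasDerivAt (fun h => M h + δ * I h) _ h := d1.add (d2.const_mul δ)
    have d4 : HasDerivAt w _ h := d1.neg.div d2 (hpos h hh').ne'
    rw [d3.deriv] at hd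
    rw [d4.deriv, div_eq_zero_iff]
    left
    simp only [Pi.neg_apply]
    linear_combination -I h * hd + deriv I h * hz
  · have := (hpos h (Ioo_subset_Icc_self hh)).ne'
    simp only [hw]
    field_simp
    linarith

instance neBot_nhds_inf_ae (x : ℝ) : (𝓝 x ⊓ MeasureTheory.ae MeasureTheory.volume).NeBot := by
  refine inf_neBot_iff.2 fun s hs t ht => ?_
  obtain ⟨y, hy, hyt⟩ := (MeasureTheory.Measure.dense_of_ae ht).inter_nhds_nonempty hs
  exact ⟨y, hyt, hy⟩

/-- Sign changes of the Melnikov functions over finitely many families of ovals give as many limit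
cycles, after perturbing `f` by a constant. -/
theorem HGe_of_sign_changes {ι : Type*} [Fintype ι] {G : ℝ → ℝ} {f g : ℝ[X]} {n m : ℕ}
    (hf : f.natDegree ≤ n) (hg : g.natDegree ≤ m) (hG : ∀ x, HasDerivAt G (g.eval x) x)
    {x₀ a b hm hp α β : ι → ℝ}
    (H : ∀ i, IsAnnulus G g.eval (x₀ i) (a i) (b i) (hm i) (hp i))
    (hαβ : ∀ i, α i < β i) (hα : ∀ i, hm i < α i) (hβ : ∀ i, β i < hp i)
    (hs : ∀ i, melnikov G f.eval (a i) (b i) (α i) * melnikov G f.eval (a i) (b i) (β i) < 0)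
    (hdisj : Pairwise fun i j =>
      Disjoint (Ioo (a i) (b i) ×ˢ Ioo (α i) (β i)) (Ioo (a j) (b j) ×ˢ Ioo (α j) (β j))) :
    HGe n m (Fintype.card ι) := by
  have hGc : ContDiff ℝ 1 G := by
    refine contDiff_one_iff_deriv.2 ⟨fun x => (hG x).differentiableAt, ?_⟩
    rw [show deriv G = g.eval from funext fun x => (hG x).deriv]
    exact g.continuous
  have hgc : ContDiff ℝ 1 g.eval := by simpa using Polynomial.contDiff_aeval (𝕜 := ℝ) g 1
  have hfc : ContDiff ℝ 1 f.eval := by simpa using Polynomial.contDiff_aeval (𝕜 := ℝ) f 1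
  obtain ⟨δ, hδ⟩ := (eventually_all.2 fun i => exists_simple_zero_of_sign_change (hαβ i)
    (fun h hh => ((H i).hasDerivAt_melnikov hG hGc hgc hfc
      ⟨(hα i).trans_le hh.1, hh.2.trans_lt (hβ i)⟩).differentiableAt)
    (fun h hh => ((H i).hasDerivAt_melnikov (f := fun _ => 1) hG hGc hgc contDiff_const
      ⟨(hα i).trans_le hh.1, hh.2.trans_lt (hβ i)⟩).differentiableAt)
    (fun h hh => (H i).melnikov_one_pos hGc.continuous
      ⟨(hα i).trans_le hh.1, hh.2.trans_lt (hβ i)⟩) (hs i)).exists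
  choose h hh hz hd using hδ
  have hmel : ∀ i, (fun h => melnikov G f.eval (a i) (b i) h
      + δ * melnikov G (fun _ => 1) (a i) (b i) h)
      = melnikov G (f + Polynomial.C δ).eval (a i) (b i) := fun i => funext fun h => by
    rw [← melnikov_add_const_mul hGc.continuous f.continuous continuous_const]
    simp
  have hcyc := fun i => (H i).exists_isLimitCycle (f := f + Polynomial.C δ) hG hGc
    (η := min (h i - α i) (β i - h i)) ⟨(hα i).trans (hh i).1, (hh i).2.trans (hβ i)⟩
    (by rw [← hmel]; exact hz i) (by rw [← hmel]; exact hd i)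
    (lt_min (sub_pos.2 (hh i).1) (sub_pos.2 (hh i).2))
  choose ε₀ hε₀ hcyc using hcyc
  obtain ⟨ε₁, hε₁, hε₁0⟩ := ((eventually_all.2 fun i =>
    (eventually_le_nhds (hε₀ i)).filter_mono nhdsWithin_le_nhds).and
    (self_mem_nhdsWithin : Ioi (0 : ℝ) ∈ 𝓝[>] 0)).exists
  refine ⟨f + Polynomial.C δ, g, (natDegree_add_C).trans_le hf, hg, ε₁, hε₁0, fun ε hε hεle => ?_⟩
  choose Γ hΓ hΓs using fun i => hcyc i ε hε (hεle.trans (hε₁ i))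
  have hinj : Function.Injective Γ := by
    intro i j hij
    by_contra hne
    obtain ⟨⟨γ, -, -, -, hγ⟩, -⟩ := hΓ i
    have hp : γ 0 ∈ Γ i := hγ ▸ mem_range_self 0
    have h1 := hΓs i hp
    have h2 := hΓs j (hij ▸ hp)
    have key : ∀ i {e : ℝ}, |e - h i| < min (h i - α i) (β i - h i) → e ∈ Ioo (α i) (β i) := by
      intro i e he
      have h3 := abs_lt.1 (lt_min_iff.1 he).1
      have h4 := abs_lt.1 (lt_min_iff.1 he).2
      constructor <;> linarith [h3.1, h4.2]
    exact (hdisj hne).notMem_of_mem_left (mk_mem_prod h1.1 (key i h1.2))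
      (mk_mem_prod h2.1 (key j h2.2))
  classical
  refine ⟨Finset.univ.image Γ, fun Γ' hΓ' => ?_, ?_⟩
  · obtain ⟨i, -, rfl⟩ := Finset.mem_image.1 hΓ'
    exact hΓ i
  · rw [Finset.card_image_of_injective _ hinj, Finset.card_univ]

/-- There are `c` sign changes of the Melnikov functions of `f`, each over an interval of levels
of an annulus, at disjoint places of the region `R` of the `(position, level)`-plane. -/
def HasSignChanges (G : ℝ → ℝ) (f g : ℝ[X]) (R : Set (ℝ × ℝ)) (c : ℕ) : Prop :=
  ∃ (ι : Type) (_ : Fintype ι) (x₀ a b hm hp α β : ι → ℝ), Fintype.card ι = c ∧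
    (∀ i, IsAnnulus G g.eval (x₀ i) (a i) (b i) (hm i) (hp i)) ∧
    (∀ i, hm i < α i ∧ α i < β i ∧ β i < hp i) ∧
    (∀ i, melnikov G f.eval (a i) (b i) (α i) * melnikov G f.eval (a i) (b i) (β i) < 0) ∧
    (∀ i, Ioo (a i) (b i) ×ˢ Ioo (α i) (β i) ⊆ R) ∧
    Pairwise fun i j =>
      Disjoint (Ioo (a i) (b i) ×ˢ Ioo (α i) (β i)) (Ioo (a j) (b j) ×ˢ Ioo (α j) (β j))

theorem HasSignChanges.HGe {G : ℝ → ℝ} {f g : ℝ[X]} {R : Set (ℝ × ℝ)} {n m c : ℕ}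
    (hc : HasSignChanges G f g R c) (hf : f.natDegree ≤ n) (hg : g.natDegree ≤ m)
    (hG : ∀ x, HasDerivAt G (g.eval x) x) : HGe n m c := by
  obtain ⟨ι, _, x₀, a, b, hm, hp, α, β, rfl, H, h, hs, -, hd⟩ := hc
  exact HGe_of_sign_changes hf hg hG H (fun i => (h i).2.1) (fun i => (h i).1)
    (fun i => (h i).2.2) hs hd

theorem HasSignChanges.union {G : ℝ → ℝ} {f g : ℝ[X]} {R R' : Set (ℝ × ℝ)} {c c' : ℕ}
    (hc : HasSignChanges G f g R c) (hc' : HasSignChanges G f g R' c') (hR : Disjoint R R') :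
    HasSignChanges G f g (R ∪ R') (c + c') := by
  obtain ⟨ι, _, x₀, a, b, hm, hp, α, β, rfl, H, h, hs, hr, hd⟩ := hc
  obtain ⟨ι', _, x₀', a', b', hm', hp', α', β', rfl, H', h', hs', hr', hd'⟩ := hc'
  refine ⟨ι ⊕ ι', inferInstance, Sum.elim x₀ x₀', Sum.elim a a', Sum.elim b b', Sum.elim hm hm',
    Sum.elim hp hp', Sum.elim α α', Sum.elim β β', Fintype.card_sum, ?_, ?_, ?_, ?_, ?_⟩
  · rintro (i | i)
    exacts [H i, H' i]
  · rintro (i | i)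
    exacts [h i, h' i]
  · rintro (i | i)
    exacts [hs i, hs' i]
  · rintro (i | i)
    exacts [(hr i).trans subset_union_left, (hr' i).trans subset_union_right]
  · rintro (i | i) (j | j) hij
    · exact hd fun h => hij (congrArg _ h)
    · exact hR.mono (hr i) (hr' j)
    · exact hR.symm.mono (hr' i) (hr j)
    · exact hd' fun h => hij (congrArg _ h)

theorem IsAnnulus.hasSignChanges {G : ℝ → ℝ} {f g : ℝ[X]} {x₀ a b hm hp : ℝ}
    (H : IsAnnulus G g.eval x₀ a b hm hp) {k : ℕ} {h : ℕ → ℝ} (hmono : StrictMono h)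
    (hmem : ∀ j ≤ k, h j ∈ Ioo hm hp)
    (hs : ∀ j < k, melnikov G f.eval a b (h j) * melnikov G f.eval a b (h (j + 1)) < 0) :
    HasSignChanges G f g (Ioo a b ×ˢ Ioo hm hp) k := by
  refine ⟨Fin k, inferInstance, fun _ => x₀, fun _ => a, fun _ => b, fun _ => hm, fun _ => hp,
    fun j => h j, fun j => h (j + 1), Fintype.card_fin k, fun _ => H,
    fun j => ⟨(hmem j j.2.le).1, hmono (Nat.lt_succ_self _), (hmem _ j.2).2⟩, fun j => hs j j.2,
    fun j => prod_mono_right (Ioo_subset_Ioo (hmem j j.2.le).1.le (hmem _ j.2).2.le), ?_⟩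
  intro i j hij
  refine disjoint_prod.2 (Or.inr ?_)
  rw [Ioo_disjoint_Ioo]
  rcases lt_or_gt_of_ne hij with hlt | hlt
  · exact (min_le_left _ _).trans ((hmono.monotone (Nat.succ_le_of_lt hlt)).trans
      (le_max_right _ _))
  · exact (min_le_right _ _).trans ((hmono.monotone (Nat.succ_le_of_lt hlt)).trans
      (le_max_left _ _))

theorem IsAnnulus.reflect {G g : ℝ → ℝ} {x₀ a b hm hp : ℝ} (H : IsAnnulus G g x₀ a b hm hp)
    (hG : ∀ x, G (-x) = G x) (hg : ∀ x, g (-x) = -g x) :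
    IsAnnulus G g (-x₀) (-b) (-a) hm hp where
  left_lt := neg_lt_neg H.lt_right
  lt_right := neg_lt_neg H.left_lt
  low := by rw [hG]; exact H.low
  high_left := by rw [hG]; exact H.high_right
  high_right := by rw [hG]; exact H.high_left
  star x hx h hh hle := by
    have := H.star (-x) ⟨by linarith [hx.2], by linarith [hx.1]⟩ h hh (by rwa [hG])
    rw [hG, hg] at this
    linarith

/-- Change of variables `u = w x` in a Melnikov function. -/
theorem melnikov_comp {K φ w w' : ℝ → ℝ} (hK : Continuous K) (hφ : Continuous φ)
    (hw : ∀ x, HasDerivAt w (w' x) x) (hw' : Continuous w') (a b h : ℝ) :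
    melnikov (fun x => K (w x)) (fun x => φ (w x) * w' x) a b h = melnikov K φ (w a) (w b) h := by
  rw [melnikov, melnikov, ← intervalIntegral.integral_comp_mul_deriv (fun x _ => hw x)
    hw'.continuousOn (by fun_prop)]
  exact intervalIntegral.integral_congr fun x _ => by
    simp only [Function.comp]
    ring

theorem melnikov_symm (G f : ℝ → ℝ) (a b h : ℝ) : melnikov G f b a h = -melnikov G f a b h :=
  intervalIntegral.integral_symm a b

theorem melnikov_self (G f : ℝ → ℝ) (a h : ℝ) : melnikov G f a a h = 0 :=
  intervalIntegral.integral_same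

theorem melnikov_eq_zero {G f : ℝ → ℝ} {a b h : ℝ} (hab : a ≤ b) (hG : ∀ x ∈ Icc a b, h ≤ G x) :
    melnikov G f a b h = 0 := by
  rw [melnikov, intervalIntegral.integral_congr (g := fun _ => 0), intervalIntegral.integral_zero]
  intro x hx
  rw [uIcc_of_le hab] at hx
  simp only
  rw [sqrt_eq_zero_of_nonpos (by linarith [hG x hx]), mul_zero]

theorem melnikov_monomial_eq_integral {p : ℕ} {φ : ℝ → ℝ} {a b h : ℝ} (ha : a < 0) (hb : 0 < b)
    (h1 : 2 * h ≤ a ^ (2 * p)) (h2 : 2 * h ≤ b ^ (2 * p)) :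
    melnikov (fun x => x ^ (2 * p) / 2) φ a b h = ∫ x, φ x * √(2 * (h - x ^ (2 * p) / 2)) := by
  refine intervalIntegral.integral_eq_integral_of_support_subset fun x hx => ?_
  have hs : 0 < 2 * (h - x ^ (2 * p) / 2) := by
    by_contra hc
    exact hx (by simp only [sqrt_eq_zero_of_nonpos (not_lt.1 hc), mul_zero])
  have hp : p ≠ 0 := by
    rintro rfl
    norm_num at hs h1
    linarith
  have key : ∀ c : ℝ, 2 * h ≤ c ^ (2 * p) → |x| < |c| := fun c hc => by
    refine lt_of_pow_lt_pow_left₀ (2 * p) (abs_nonneg c) ?_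
    rw [(even_two_mul p).pow_abs, (even_two_mul p).pow_abs]
    linarith
  have k1 := key a h1
  have k2 := key b h2
  rw [abs_of_neg ha] at k1
  rw [abs_of_pos hb] at k2
  exact ⟨by linarith [(abs_lt.1 k1).1], (abs_lt.1 k2).2.le⟩

theorem integral_monomial_pos {p : ℕ} (i : ℕ) :
    0 < ∫ t in (-2 : ℝ)..2, t ^ (2 * i) * √(2 - t ^ (2 * p)) := by
  refine intervalIntegral.integral_pos (by norm_num) (Continuous.continuousOn (by fun_prop))
    (fun t _ => mul_nonneg ((even_two_mul i).pow_nonneg t) (sqrt_nonneg _)) ⟨1, by norm_num, ?_⟩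
  norm_num

/-- On the levels `r ^ (2 * p)`, the Melnikov function of `q (x ^ 2)` is, up to a positive factor,
a polynomial in `r ^ 2` whose coefficients are positive multiples of those of `q`. -/
theorem melnikov_monomial_scale {p : ℕ} (q : ℝ[X]) {r : ℝ} (hr : 0 < r) :
    melnikov (fun x => x ^ (2 * p) / 2) (fun x => q.eval (x ^ 2)) (-2 * r) (2 * r) (r ^ (2 * p)) =
      r ^ (p + 1) * ∑ i ∈ Finset.range (q.natDegree + 1),
        q.coeff i * (∫ t in (-2 : ℝ)..2, t ^ (2 * i) * √(2 - t ^ (2 * p))) * (r ^ 2) ^ i := by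
  have h1 : ∀ t : ℝ, q.eval ((t * r) ^ 2) * √(2 * (r ^ (2 * p) - (t * r) ^ (2 * p) / 2)) =
      ∑ i ∈ Finset.range (q.natDegree + 1),
        (r ^ p * q.coeff i * (r ^ 2) ^ i) * (t ^ (2 * i) * √(2 - t ^ (2 * p))) := fun t => by
    have e : √(2 * (r ^ (2 * p) - (t * r) ^ (2 * p) / 2)) = r ^ p * √(2 - t ^ (2 * p)) := by
      rw [show 2 * (r ^ (2 * p) - (t * r) ^ (2 * p) / 2) = (r ^ p) ^ 2 * (2 - t ^ (2 * p)) by ring,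
        sqrt_mul (sq_nonneg _), sqrt_sq (pow_pos hr p).le]
    rw [e, eval_eq_sum_range, Finset.sum_mul]
    refine Finset.sum_congr rfl fun i _ => ?_
    ring
  have h2 := intervalIntegral.mul_integral_comp_mul_right (a := -2) (b := 2)
    (f := fun x => q.eval (x ^ 2) * √(2 * (r ^ (2 * p) - x ^ (2 * p) / 2))) r
  rw [melnikov, ← h2]
  simp only [h1]
  rw [intervalIntegral.integral_finsetSum fun i _ =>
    Continuous.intervalIntegrable (by fun_prop) _ _, Finset.mul_sum, Finset.mul_sum]
  refine Finset.sum_congr rfl fun i _ => ?_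
  rw [intervalIntegral.integral_const_mul]
  ring

theorem exists_melnikov_monomial_eq {p : ℕ} (hp : p ≠ 0) (Q : ℝ[X]) :
    ∃ q : ℝ[X], q.natDegree ≤ Q.natDegree ∧ ∀ s, 0 < s → ∀ a b, a < 0 → 0 < b →
      2 * s ^ p ≤ a ^ (2 * p) → 2 * s ^ p ≤ b ^ (2 * p) →
      melnikov (fun x => x ^ (2 * p) / 2) (fun x => q.eval (x ^ 2)) a b (s ^ p) =
        √s ^ (p + 1) * Q.eval s := by
  set I : ℕ → ℝ := fun i => ∫ t in (-2 : ℝ)..2, t ^ (2 * i) * √(2 - t ^ (2 * p)) with hI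
  have hIpos : ∀ i, 0 < I i := integral_monomial_pos
  set q : ℝ[X] := ∑ i ∈ Finset.range (Q.natDegree + 1), monomial i (Q.coeff i / I i) with hq
  have hdeg : q.natDegree ≤ Q.natDegree := natDegree_sum_le_of_forall_le _ _ fun i hi =>
    (natDegree_monomial_le _).trans (Nat.lt_succ_iff.1 (Finset.mem_range.1 hi))
  have hco : ∀ i, q.coeff i * I i = Q.coeff i := fun i => by
    have h0 := (hIpos i).ne'
    rw [hq, finsetSum_coeff]
    simp only [coeff_monomial, Finset.sum_ite_eq', Finset.mem_range]
    split_ifs with h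
    · field_simp
    · rw [zero_mul, coeff_eq_zero_of_natDegree_lt (by omega)]
  refine ⟨q, hdeg, fun s hs a b ha hb h1 h2 => ?_⟩
  have hr := sqrt_pos.2 hs
  have hsr : s ^ p = √s ^ (2 * p) := by rw [pow_mul, sq_sqrt hs.le]
  have h4 : 2 * s ^ p ≤ (2 * √s) ^ (2 * p) := by
    rw [mul_pow, ← hsr]
    exact mul_le_mul_of_nonneg_right (le_self_pow₀ (by norm_num) (by omega)) (pow_pos hs p).le
  rw [melnikov_monomial_eq_integral ha hb h1 h2,
    ← melnikov_monomial_eq_integral (a := -2 * √s) (b := 2 * √s) (by linarith) (by linarith)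
      (by rw [neg_mul, (even_two_mul p).neg_pow]; exact h4) h4, hsr, melnikov_monomial_scale q hr,
    sq_sqrt hs.le, eval_eq_sum_range' (Nat.lt_succ_iff.2 le_rfl)]
  congr 1
  rw [← Finset.sum_subset (Finset.range_mono (Nat.succ_le_succ hdeg))]
  · exact Finset.sum_congr rfl fun i _ => by rw [← hco i]
  · intro i _ hi
    rw [← hco i, coeff_eq_zero_of_natDegree_lt (by simpa using hi)]
    simp

/-- A polynomial with `k` sign changes on equidistant points. -/
theorem exists_alternating_polynomial (k : ℕ) {d : ℝ} (hd : d ≠ 0) (s₀ : ℝ) :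
    ∃ Q : ℝ[X], Q.natDegree ≤ k ∧
      ∀ j < k, Q.eval (s₀ + j * d) * Q.eval (s₀ + (j + 1 : ℕ) * d) < 0 := by
  refine ⟨∏ i ∈ Finset.range k, (X - C (s₀ + (i + 1 / 2) * d)), ?_, fun j hj => ?_⟩
  · exact (natDegree_prod_le _ _).trans ((Finset.sum_le_card_nsmul _ _ 1 fun i _ =>
      natDegree_X_sub_C_le _).trans (by simp))
  · rw [eval_prod, eval_prod, ← Finset.prod_mul_distrib]
    have hterm : ∀ i : ℕ, eval (s₀ + j * d) (X - C (s₀ + (i + 1 / 2) * d)) *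
        eval (s₀ + (j + 1 : ℕ) * d) (X - C (s₀ + (i + 1 / 2) * d)) =
        d ^ 2 * (((j : ℝ) - i) ^ 2 - 1 / 4) := fun i => by
      simp only [eval_sub, eval_X, eval_C]
      push_cast
      ring
    simp only [hterm]
    have hd2 : 0 < d ^ 2 := by positivity
    rw [← Finset.mul_prod_erase _ _ (Finset.mem_range.2 hj)]
    refine mul_neg_of_neg_of_pos (by simpa using hd2) (Finset.prod_pos fun i hi => ?_)
    refine mul_pos hd2 ?_
    have h1 : (1 : ℤ) ≤ |(j : ℤ) - i| :=
      Int.one_le_abs (sub_ne_zero.2 (by exact_mod_cast (Finset.ne_of_mem_erase hi).symm))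
    have h2 : (1 : ℝ) ≤ |(j : ℝ) - i| := by exact_mod_cast h1
    rw [← sq_abs]
    nlinarith

/-- Polynomials `q` for which the Melnikov function of `q (x ^ 2)` has prescribed many sign changes
on the levels between `lo ^ p` and `hi ^ p` of the potential `x ^ (2 * p) / 2`. -/
theorem exists_alternating_melnikov {p : ℕ} (hp : p ≠ 0) (k : ℕ) {lo hi : ℝ} (hlo : 0 < lo)
    (hlt : lo < hi) :
    ∃ (q : ℝ[X]) (h m : ℕ → ℝ), q.natDegree ≤ k ∧ StrictMono h ∧
      (∀ j ≤ k, h j ∈ Ioo (lo ^ p) (hi ^ p)) ∧ (∀ j < k, m j * m (j + 1) < 0) ∧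
      ∀ j a b, a < 0 → 0 < b → 2 * h j ≤ a ^ (2 * p) → 2 * h j ≤ b ^ (2 * p) →
        melnikov (fun x => x ^ (2 * p) / 2) (fun x => q.eval (x ^ 2)) a b (h j) = m j := by
  set d : ℝ := (hi - lo) / (k + 2) with hd
  have hk : (0 : ℝ) < k + 2 := by positivity
  have hd0 : 0 < d := div_pos (by linarith) hk
  have hdk : (k + 2) * d = hi - lo := by
    rw [hd]
    field_simp
  obtain ⟨Q, hQ, hsign⟩ := exists_alternating_polynomial k hd0.ne' (lo + d)
  obtain ⟨q, hq, hmel⟩ := exists_melnikov_monomial_eq hp Q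
  have hspos : ∀ j : ℕ, lo < lo + d + j * d := fun j => by
    have : 0 ≤ j * d := by positivity
    linarith
  refine ⟨q, fun j => (lo + d + j * d) ^ p, fun j => √(lo + d + j * d) ^ (p + 1) *
    Q.eval (lo + d + j * d), hq.trans hQ, fun i j hij => ?_, fun j hj => ⟨?_, ?_⟩, fun j hj => ?_,
    fun j a b ha hb h1 h2 => hmel _ (hlo.trans (hspos j)) a b ha hb h1 h2⟩
  · have : (i : ℝ) < j := by exact_mod_cast hij
    exact pow_lt_pow_left₀ (by nlinarith) (hlo.trans (hspos i)).le hp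
  · exact pow_lt_pow_left₀ (hspos j) hlo.le hp
  · refine pow_lt_pow_left₀ ?_ (hlo.trans (hspos j)).le hp
    have : (j : ℝ) ≤ k := by exact_mod_cast hj
    nlinarith
  · have e1 := pow_pos (sqrt_pos.2 (hlo.trans (hspos j))) (p + 1)
    have e2 := pow_pos (sqrt_pos.2 (hlo.trans (hspos (j + 1)))) (p + 1)
    have := mul_neg_of_pos_of_neg (mul_pos e1 e2) (hsign j hj)
    simp only
    linarith

/-- The polynomial `(x² - c₁)² - c₂`. -/
noncomputable def layered (c₁ c₂ x : ℝ) : ℝ := (x ^ 2 - c₁) ^ 2 - c₂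

/-- The derivative of the potential `layered c₁ c₂ x ^ 2 / 2`. -/
noncomputable def layeredForce (c₁ c₂ : ℝ) : ℝ[X] :=
  ((X ^ 2 - C c₁) ^ 2 - C c₂) * (4 * X * (X ^ 2 - C c₁))

theorem layeredForce_eval (c₁ c₂ x : ℝ) :
    (layeredForce c₁ c₂).eval x = layered c₁ c₂ x * (4 * x * (x ^ 2 - c₁)) := by
  simp [layeredForce, layered]

theorem natDegree_layeredForce_le (c₁ c₂ : ℝ) : (layeredForce c₁ c₂).natDegree ≤ 7 := by
  unfold layeredForce
  compute_degree

theorem hasDerivAt_layered (c₁ c₂ x : ℝ) :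
    HasDerivAt (layered c₁ c₂) (4 * x * (x ^ 2 - c₁)) x := by
  refine (((((hasDerivAt_id x).pow 2).sub_const c₁).pow 2).sub_const c₂).congr_deriv ?_
  simp
  ring

theorem hasDerivAt_layered_potential (c₁ c₂ x : ℝ) :
    HasDerivAt (fun x => layered c₁ c₂ x ^ 2 / 2) ((layeredForce c₁ c₂).eval x) x := by
  refine (((hasDerivAt_layered c₁ c₂ x).pow 2).div_const 2).congr_deriv ?_
  rw [layeredForce_eval]
  simp
  ring

theorem layered_neg (c₁ c₂ x : ℝ) : layered c₁ c₂ (-x) = layered c₁ c₂ x := by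
  simp [layered]

theorem layeredForce_eval_neg (c₁ c₂ x : ℝ) :
    (layeredForce c₁ c₂).eval (-x) = -(layeredForce c₁ c₂).eval x := by
  rw [layeredForce_eval, layeredForce_eval, layered_neg]
  ring

section
variable {c₁ c₂ : ℝ}

theorem layered_three_le (h₁ : 0 < c₁) (h₁' : c₁ ≤ 1 / 10) (h₂' : c₂ ≤ c₁ ^ 2 / 10) :
    32 ≤ layered c₁ c₂ 3 := by
  unfold layered
  nlinarith

theorem isAnnulus_outer (h₁ : 0 < c₁) (h₁' : c₁ ≤ 1 / 10) (h₂ : 0 < c₂) (h₂' : c₂ ≤ c₁ ^ 2 / 10) :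
    IsAnnulus (fun x => layered c₁ c₂ x ^ 2 / 2) (layeredForce c₁ c₂).eval 0 (-3) 3 1 16 := by
  have h3 := layered_three_le h₁ h₁' h₂'
  have hc : c₁ ^ 2 ≤ 1 / 100 := by nlinarith
  have h0 : layered c₁ c₂ 0 ^ 2 ≤ 1 := by
    unfold layered
    nlinarith
  refine ⟨by norm_num, by norm_num, by linarith, ?_, ?_, ?_⟩
  · rw [layered_neg]
    nlinarith
  · nlinarith
  · intro x _ h hh hle
    rw [layeredForce_eval, sub_zero]
    set v := layered c₁ c₂ x with hv
    obtain ⟨u, hu⟩ : ∃ u, u = x ^ 2 - c₁ := ⟨_, rfl⟩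
    have hvu : v = u ^ 2 - c₂ := by rw [hv, layered, hu]
    rw [← hu]
    rcases le_or_gt (u * v) 0 with huv | huv
    · have hb : u ^ 2 ≤ 1 / 100 ∧ -(1 / 100) ≤ v ∧ v ≤ 1 / 100 := by
        have hx := sq_nonneg x
        rcases le_total u 0 with h0 | h0
        · have : u ^ 2 ≤ c₁ ^ 2 := by nlinarith
          refine ⟨by linarith, by nlinarith, by nlinarith⟩
        · have hv0 : u ^ 2 ≤ 1 / 100 := by
            by_contra hcon
            have : 0 < v := by nlinarith
            have : 0 < u := by
              rcases h0.eq_or_lt with rfl | h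
              · norm_num at hcon
              · exact h
            nlinarith [mul_pos this ‹0 < v›]
          refine ⟨hv0, by nlinarith, by nlinarith⟩
      have hua := abs_le_of_sq_le_sq (a := u) (b := 1 / 10) (by linarith) (by norm_num)
      have hx2 : x ^ 2 ≤ 1 / 5 := by linarith [(abs_le.1 hua).2]
      have huv' : -(1 / 1000) ≤ u * v := by
        have := abs_le.2 hb.2
        have h4 : |u * v| ≤ 1 / 10 * (1 / 100) := by
          rw [abs_mul]
          exact mul_le_mul hua this (abs_nonneg _) (by norm_num)
        linarith [(abs_le.1 h4).1]
      have h5 : v ^ 2 ≤ 1 / 100 := by nlinarith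
      nlinarith [hh.1, sq_nonneg x]
    · rcases eq_or_ne x 0 with rfl | hx
      · have := hh.1
        rw [← hv] at h0
        nlinarith
      · have : 0 < x ^ 2 := by positivity
        nlinarith [mul_pos this huv]

theorem isAnnulus_middle (h₁ : 0 < c₁) (h₁' : c₁ ≤ 1 / 10) (h₂ : 0 < c₂)
    (h₂' : c₂ ≤ c₁ ^ 2 / 10) :
    IsAnnulus (fun x => layered c₁ c₂ x ^ 2 / 2) (layeredForce c₁ c₂).eval (√c₁) 0 3
      ((2 / 5 * c₁ ^ 2) ^ 2) ((1 / 2 * c₁ ^ 2) ^ 2) := by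
  have h3 := layered_three_le h₁ h₁' h₂'
  have hs := sqrt_pos.2 h₁
  have hs2 := sq_sqrt h₁.le
  have hc : c₁ ^ 2 ≤ 1 / 100 := by nlinarith
  have hq : c₂ ^ 2 ≤ (c₁ ^ 2 / 10) ^ 2 := pow_le_pow_left₀ h₂.le h₂' 2
  have hc4 : 0 < (c₁ ^ 2) ^ 2 := by positivity
  refine ⟨hs, by nlinarith, ?_, ?_, ?_, ?_⟩
  · simp only [layered, hs2]
    nlinarith
  · simp only [layered]
    nlinarith
  · nlinarith
  · intro x hx h hh hle
    rw [layeredForce_eval]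
    set v := layered c₁ c₂ x with hv
    obtain ⟨s, hs'⟩ : ∃ s, s = √c₁ := ⟨_, rfl⟩
    rw [← hs'] at hs hs2 ⊢
    obtain ⟨u, hu⟩ : ∃ u, u = (x - s) * (x + s) := ⟨_, rfl⟩
    have hvu : v = u ^ 2 - c₂ := by rw [hv, layered, hu, ← hs2]; ring
    have hE : (x - s) * (v * (4 * x * (x ^ 2 - c₁))) = 4 * (x * (x + s) * (x - s) ^ 2) * v := by
      rw [← hs2]; ring
    rw [hE]
    have hxp : 0 < x := hx.1
    have hA : 0 ≤ x * (x + s) * (x - s) ^ 2 := by positivity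
    have hAu : x * (x + s) * (x - s) ^ 2 ≤ u ^ 2 := by
      have : u ^ 2 - x * (x + s) * (x - s) ^ 2 = s * (x + s) * (x - s) ^ 2 := by rw [hu]; ring
      have : 0 ≤ s * (x + s) * (x - s) ^ 2 := by positivity
      linarith
    have hh1 := hh.1
    rcases lt_or_ge 0 v with hv0 | hv0
    · rcases hA.eq_or_lt with h0 | h0
      · have hxs : x - s = 0 := by
          by_contra hne
          have : 0 < x * (x + s) * (x - s) ^ 2 := by positivity
          linarith
        rw [hxs, zero_mul] at hu
        rw [hu] at hvu
        nlinarith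
      · nlinarith [mul_pos h0 hv0]
    · have hv1 : -c₂ ≤ v := by nlinarith [sq_nonneg u]
      have hv2 : v ^ 2 ≤ c₂ ^ 2 := by nlinarith
      have : -(c₂ * c₂) ≤ x * (x + s) * (x - s) ^ 2 * v := by
        have h1 : x * (x + s) * (x - s) ^ 2 ≤ c₂ := by linarith
        nlinarith
      nlinarith

/-- The star-shapedness condition near a nondegenerate zero of `layered c₁ c₂`. -/
theorem layered_star {τ x₀ x h : ℝ} (hx₀ : 0 < x₀) (hx : 0 < x) (h2 : τ ^ 2 = c₂)
    (h0 : x₀ ^ 2 = c₁ + τ) (hu : 0 < (x ^ 2 - c₁) * (x ^ 2 - c₁ + τ)) (hh : 0 < h)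
    (hle : layered c₁ c₂ x ^ 2 / 2 ≤ h) :
    0 < (x - x₀) * (layeredForce c₁ c₂).eval x + 2 * (h - layered c₁ c₂ x ^ 2 / 2) := by
  have e1 : layered c₁ c₂ x = (x ^ 2 - c₁ + τ) * ((x - x₀) * (x + x₀)) := by
    rw [layered, ← h2]
    linear_combination (x ^ 2 - c₁ + τ) * h0
  have e2 : (x - x₀) * (layeredForce c₁ c₂).eval x =
      4 * x * (x + x₀) * (x - x₀) ^ 2 * ((x ^ 2 - c₁) * (x ^ 2 - c₁ + τ)) := by
    rw [layeredForce_eval, e1]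
    ring
  rw [e2]
  rcases eq_or_ne x x₀ with rfl | hne
  · rw [e1, sub_self]
    linarith
  · have := sub_ne_zero.2 hne
    have : 0 < 4 * x * (x + x₀) * (x - x₀) ^ 2 * ((x ^ 2 - c₁) * (x ^ 2 - c₁ + τ)) :=
      mul_pos (by positivity) hu
    linarith

theorem isAnnulus_inner_right (h₁ : 0 < c₁) (h₁' : c₁ ≤ 1 / 10) (h₂ : 0 < c₂)
    (h₂' : c₂ ≤ c₁ ^ 2 / 10) :
    IsAnnulus (fun x => layered c₁ c₂ x ^ 2 / 2) (layeredForce c₁ c₂).eval (√(c₁ + √c₂)) (√c₁) 3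
      0 (c₂ ^ 2 / 2) := by
  have h3 := layered_three_le h₁ h₁' h₂'
  have ht := sqrt_pos.2 h₂
  have ht2 := sq_sqrt h₂.le
  have hx₀ : √(c₁ + √c₂) ^ 2 = c₁ + √c₂ := sq_sqrt (by positivity)
  have ht1 : √c₂ < c₁ := by nlinarith
  have hc2 : c₂ ≤ 1 := by nlinarith
  have hs2 := sq_sqrt h₁.le
  refine ⟨sqrt_lt_sqrt h₁.le (by linarith), ?_, ?_, ?_, ?_, fun x hx h hh hle => ?_⟩
  · have : √(c₁ + √c₂) < √9 := sqrt_lt_sqrt (by positivity) (by linarith)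
    rwa [show (9 : ℝ) = 3 ^ 2 by norm_num, sqrt_sq (by norm_num)] at this
  · simp only [layered, hx₀]
    rw [add_sub_cancel_left, ht2]
    norm_num
  · simp [layered, hs2]
  · nlinarith
  · have hxp : 0 < x := (sqrt_nonneg _).trans_lt hx.1
    have : c₁ < x ^ 2 := (sqrt_lt' hxp).1 hx.1
    have : 0 < x ^ 2 - c₁ := by linarith
    exact layered_star (by positivity) hxp ht2 hx₀ (by positivity) hh.1 hle

theorem isAnnulus_inner_left (h₁ : 0 < c₁) (h₁' : c₁ ≤ 1 / 10) (h₂ : 0 < c₂)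
    (h₂' : c₂ ≤ c₁ ^ 2 / 10) :
    IsAnnulus (fun x => layered c₁ c₂ x ^ 2 / 2) (layeredForce c₁ c₂).eval (√(c₁ - √c₂)) 0 (√c₁)
      0 (c₂ ^ 2 / 2) := by
  have ht := sqrt_pos.2 h₂
  have ht2 := sq_sqrt h₂.le
  have ht1 : √c₂ < c₁ := by nlinarith
  have hx₀ : √(c₁ - √c₂) ^ 2 = c₁ + -√c₂ := sq_sqrt (by linarith)
  have hpos : 0 < √(c₁ - √c₂) := sqrt_pos.2 (by linarith)
  have hs2 := sq_sqrt h₁.le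
  refine ⟨hpos, sqrt_lt_sqrt (by linarith) (by linarith), ?_, ?_, ?_, fun x hx h hh hle => ?_⟩
  · simp only [layered, hx₀]
    rw [add_sub_cancel_left, neg_sq, ht2]
    norm_num
  · simp only [layered]
    have : c₂ ^ 2 ≤ (c₁ ^ 2 - c₂) ^ 2 := pow_le_pow_left₀ h₂.le (by linarith) 2
    nlinarith
  · simp [layered, hs2]
  · have : x ^ 2 < c₁ := (lt_sqrt hx.1.le).1 hx.2
    have h4 : x ^ 2 - c₁ < 0 := by linarith
    exact layered_star (τ := -√c₂) hpos hx.1 (by rw [neg_sq, ht2]) hx₀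
      (mul_pos_of_neg_of_neg h4 (by linarith)) hh.1 hle

end

theorem HasSignChanges.mono {G : ℝ → ℝ} {f g : ℝ[X]} {R R' : Set (ℝ × ℝ)} {c : ℕ}
    (hc : HasSignChanges G f g R c) (hR : R ⊆ R') : HasSignChanges G f g R' c := by
  obtain ⟨ι, _, x₀, a, b, hm, hp, α, β, hcard, H, h, hs, hr, hd⟩ := hc
  exact ⟨ι, inferInstance, x₀, a, b, hm, hp, α, β, hcard, H, h, hs, fun i => (hr i).trans hR, hd⟩

theorem melnikov_perturbation {G : ℝ → ℝ} (hG : Continuous G) (f₁ f₂ f₃ : ℝ[X]) (ε a b h : ℝ) :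
    melnikov G (f₁ + C ε * f₂ + C (ε ^ 2) * f₃).eval a b h =
      melnikov G f₁.eval a b h + ε * melnikov G f₂.eval a b h +
        ε ^ 2 * melnikov G f₃.eval a b h := by
  rw [← melnikov_add_const_mul hG f₁.continuous f₂.continuous,
    ← melnikov_add_const_mul hG (by fun_prop) f₃.continuous]
  simp

section
variable {G : ℝ → ℝ} {a b : ℝ} {h : ℕ → ℝ} {k : ℕ}

theorem eventually_sign_changes_of_first (hG : Continuous G) (f₁ f₂ f₃ : ℝ[X])
    (hs : ∀ j < k, melnikov G f₁.eval a b (h j) * melnikov G f₁.eval a b (h (j + 1)) < 0) :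
    ∀ᶠ ε in 𝓝[>] 0, ∀ j < k, melnikov G (f₁ + C ε * f₂ + C (ε ^ 2) * f₃).eval a b (h j) *
      melnikov G (f₁ + C ε * f₂ + C (ε ^ 2) * f₃).eval a b (h (j + 1)) < 0 := by
  refine ((eventually_all_finite (finite_Iio k)).2 fun j hj => ?_).filter_mono nhdsWithin_le_nhds
  simp only [melnikov_perturbation hG]
  refine (Continuous.tendsto (by fun_prop) 0).eventually (gt_mem_nhds ?_)
  simpa using hs j hj

theorem eventually_sign_changes_of_second (hG : Continuous G) {f₁ : ℝ[X]} (f₂ f₃ : ℝ[X])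
    (h₁ : ∀ j ≤ k, melnikov G f₁.eval a b (h j) = 0)
    (hs : ∀ j < k, melnikov G f₂.eval a b (h j) * melnikov G f₂.eval a b (h (j + 1)) < 0) :
    ∀ᶠ ε in 𝓝[>] 0, ∀ j < k, melnikov G (f₁ + C ε * f₂ + C (ε ^ 2) * f₃).eval a b (h j) *
      melnikov G (f₁ + C ε * f₂ + C (ε ^ 2) * f₃).eval a b (h (j + 1)) < 0 := by
  refine (eventually_all_finite (finite_Iio k)).2 fun j hj => ?_
  have hev : ∀ᶠ ε in 𝓝 (0 : ℝ),
      (melnikov G f₂.eval a b (h j) + ε * melnikov G f₃.eval a b (h j)) *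
      (melnikov G f₂.eval a b (h (j + 1)) + ε * melnikov G f₃.eval a b (h (j + 1))) < 0 := by
    refine (Continuous.tendsto (by fun_prop) 0).eventually (gt_mem_nhds ?_)
    simpa using hs j hj
  filter_upwards [hev.filter_mono nhdsWithin_le_nhds, self_mem_nhdsWithin] with ε hε hε0
  rw [melnikov_perturbation hG, melnikov_perturbation hG, h₁ j (le_of_lt hj), h₁ _ hj]
  have := mul_neg_of_pos_of_neg (pow_pos (mem_Ioi.1 hε0) 2) hε
  linarith

theorem sign_changes_of_third (hG : Continuous G) {f₁ f₂ : ℝ[X]} (f₃ : ℝ[X])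
    (h₁ : ∀ j ≤ k, melnikov G f₁.eval a b (h j) = 0)
    (h₂ : ∀ j ≤ k, melnikov G f₂.eval a b (h j) = 0)
    (hs : ∀ j < k, melnikov G f₃.eval a b (h j) * melnikov G f₃.eval a b (h (j + 1)) < 0)
    {ε : ℝ} (hε : 0 < ε) :
    ∀ j < k, melnikov G (f₁ + C ε * f₂ + C (ε ^ 2) * f₃).eval a b (h j) *
      melnikov G (f₁ + C ε * f₂ + C (ε ^ 2) * f₃).eval a b (h (j + 1)) < 0 := by
  intro j hj
  rw [melnikov_perturbation hG, melnikov_perturbation hG, h₁ j hj.le, h₁ _ hj, h₂ j hj.le, h₂ _ hj]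
  have := mul_neg_of_pos_of_neg (pow_pos hε 4) (hs j hj)
  linarith

end

theorem melnikov_layered_inner (q : ℝ[X]) (c₁ c₂ a b h : ℝ) :
    melnikov (fun x => layered c₁ c₂ x ^ 2 / 2)
      (q.comp (((X ^ 2 - C c₁) ^ 2 - C c₂) ^ 2) * (4 * X * (X ^ 2 - C c₁))).eval a b h =
    melnikov (fun v => v ^ (2 * 1) / 2) (fun v => q.eval (v ^ 2)) (layered c₁ c₂ a)
      (layered c₁ c₂ b) h := by
  rw [← melnikov_comp (w := layered c₁ c₂) (w' := fun x => 4 * x * (x ^ 2 - c₁)) (by fun_prop)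
    (by fun_prop) (hasDerivAt_layered c₁ c₂) (by fun_prop)]
  congr 1
  ext x
  simp [layered]

theorem melnikov_layered_middle (q : ℝ[X]) (c₁ c₂ a b h : ℝ) :
    melnikov (fun x => layered c₁ c₂ x ^ 2 / 2)
      (q.comp ((X ^ 2 - C c₁) ^ 2) * (2 * X)).eval a b h =
    melnikov (fun u => (u ^ 2 - c₂) ^ 2 / 2) (fun u => q.eval (u ^ 2)) (a ^ 2 - c₁)
      (b ^ 2 - c₁) h := by
  rw [← melnikov_comp (w := fun x => x ^ 2 - c₁) (w' := fun x => 2 * x) (by fun_prop)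
    (by fun_prop) (fun x => by simpa using ((hasDerivAt_id x).pow 2).sub_const c₁) (by fun_prop)]
  congr 1
  ext x
  simp

/-- For polynomials `q`, the family of potentials `layered c₁ c₂ ^ 2 / 2` has near `c₁ = c₂ = 0`
the sign changes of `x ^ 8 / 2`. -/
theorem eventually_outer_sign_changes (q : ℝ[X]) {h m : ℕ → ℝ} {k : ℕ}
    (hs : ∀ j < k, m j * m (j + 1) < 0)
    (hm : ∀ j ≤ k, melnikov (fun x => x ^ (2 * 4) / 2) (fun x => q.eval (x ^ 2)) (-3) 3 (h j)
      = m j) :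
    ∀ᶠ c₁ in 𝓝 (0 : ℝ), ∀ᶠ c₂ in 𝓝 (0 : ℝ), ∀ j < k,
      melnikov (fun x => layered c₁ c₂ x ^ 2 / 2) (q.comp (X ^ 2)).eval (-3) 3 (h j) *
      melnikov (fun x => layered c₁ c₂ x ^ 2 / 2) (q.comp (X ^ 2)).eval (-3) 3 (h (j + 1)) < 0 := by
  have hc : ∀ t, Continuous fun c : ℝ × ℝ =>
      melnikov (fun x => layered c.1 c.2 x ^ 2 / 2) (q.comp (X ^ 2)).eval (-3) 3 t := fun t => by
    refine intervalIntegral.continuous_parametric_intervalIntegral_of_continuous' ?_ _ _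
    simp only [Function.uncurry_def, layered]
    fun_prop
  have h0 : ∀ t, melnikov (fun x => layered 0 0 x ^ 2 / 2) (q.comp (X ^ 2)).eval (-3) 3 t =
      melnikov (fun x => x ^ (2 * 4) / 2) (fun x => q.eval (x ^ 2)) (-3) 3 t := fun t => by
    congr 1
    · ext x
      simp only [layered]
      ring
    · ext x
      simp
  refine Eventually.curry (p := fun c : ℝ × ℝ => ∀ j < k,
    melnikov (fun x => layered c.1 c.2 x ^ 2 / 2) (q.comp (X ^ 2)).eval (-3) 3 (h j) *
    melnikov (fun x => layered c.1 c.2 x ^ 2 / 2) (q.comp (X ^ 2)).eval (-3) 3 (h (j + 1)) < 0) ?_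
  rw [← nhds_prod_eq]
  refine (eventually_all_finite (finite_Iio k)).2 fun j hj => ?_
  refine (((hc (h j)).mul (hc (h (j + 1)))).tendsto (0, 0)).eventually (gt_mem_nhds ?_)
  exact (congrArg₂ (· * ·) ((h0 _).trans (hm j (le_of_lt hj))) ((h0 _).trans (hm _ hj))).trans_lt
    (hs j hj)

theorem eventually_middle_sign_changes (q : ℝ[X]) {a b : ℝ} {h m : ℕ → ℝ} {k : ℕ}
    (hs : ∀ j < k, m j * m (j + 1) < 0)
    (hm : ∀ j ≤ k, melnikov (fun x => x ^ (2 * 2) / 2) (fun x => q.eval (x ^ 2)) a b (h j)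
      = m j) :
    ∀ᶠ c in 𝓝 (0 : ℝ), ∀ j < k,
      melnikov (fun u => (u ^ 2 - c) ^ 2 / 2) (fun u => q.eval (u ^ 2)) a b (h j) *
      melnikov (fun u => (u ^ 2 - c) ^ 2 / 2) (fun u => q.eval (u ^ 2)) a b (h (j + 1)) < 0 := by
  have hc : ∀ t, Continuous fun c : ℝ =>
      melnikov (fun u => (u ^ 2 - c) ^ 2 / 2) (fun u => q.eval (u ^ 2)) a b t := fun t => by
    refine intervalIntegral.continuous_parametric_intervalIntegral_of_continuous' ?_ _ _
    simp only [Function.uncurry_def]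
    fun_prop
  have h0 : ∀ t, melnikov (fun u => (u ^ 2 - 0) ^ 2 / 2) (fun u => q.eval (u ^ 2)) a b t =
      melnikov (fun x => x ^ (2 * 2) / 2) (fun x => q.eval (x ^ 2)) a b t := fun t => by
    congr 1
    ext x
    ring
  refine (eventually_all_finite (finite_Iio k)).2 fun j hj => ?_
  refine (((hc (h j)).mul (hc (h (j + 1)))).tendsto 0).eventually (gt_mem_nhds ?_)
  exact (congrArg₂ (· * ·) ((h0 _).trans (hm j (le_of_lt hj))) ((h0 _).trans (hm _ hj))).trans_lt
    (hs j hj)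

theorem natDegree_inner_le {q : ℝ[X]} {k : ℕ} (hq : q.natDegree ≤ k) (c₁ c₂ : ℝ) :
    (q.comp (((X ^ 2 - C c₁) ^ 2 - C c₂) ^ 2) * (4 * X * (X ^ 2 - C c₁))).natDegree
      ≤ 8 * k + 3 := by
  have h1 : ((((X ^ 2 - C c₁) ^ 2 - C c₂) ^ 2 : ℝ[X])).natDegree ≤ 8 := by compute_degree
  have h2 : ((4 * X * (X ^ 2 - C c₁) : ℝ[X])).natDegree ≤ 3 := by compute_degree
  have h3 : (q.comp (((X ^ 2 - C c₁) ^ 2 - C c₂) ^ 2)).natDegree ≤ k * 8 :=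
    natDegree_comp_le.trans (Nat.mul_le_mul hq h1)
  exact natDegree_mul_le.trans (by omega)

theorem natDegree_middle_le {q : ℝ[X]} {k : ℕ} (hq : q.natDegree ≤ k) (c₁ : ℝ) :
    (q.comp ((X ^ 2 - C c₁) ^ 2) * (2 * X)).natDegree ≤ 4 * k + 1 := by
  have h1 : (((X ^ 2 - C c₁) ^ 2 : ℝ[X])).natDegree ≤ 4 := by compute_degree
  have h2 : ((2 * X : ℝ[X])).natDegree ≤ 1 := by compute_degree
  have h3 : (q.comp ((X ^ 2 - C c₁) ^ 2)).natDegree ≤ k * 4 :=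
    natDegree_comp_le.trans (Nat.mul_le_mul hq h1)
  exact natDegree_mul_le.trans (by omega)

theorem natDegree_outer_le {q : ℝ[X]} {k : ℕ} (hq : q.natDegree ≤ k) :
    (q.comp (X ^ 2)).natDegree ≤ 2 * k := by
  have h3 : (q.comp (X ^ 2)).natDegree ≤ k * 2 :=
    natDegree_comp_le.trans (Nat.mul_le_mul hq (natDegree_X_pow_le 2))
  omega

/-- Sign changes over two annuli symmetric about the `x = 0` line. -/
theorem HasSignChanges.union_symm {G : ℝ → ℝ} {f g : ℝ[X]} {hm hp : ℝ} {c c' : ℕ}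
    (hc : HasSignChanges G f g (Ioi 0 ×ˢ Ioo hm hp) c)
    (hc' : HasSignChanges G f g (Iio 0 ×ˢ Ioo hm hp) c') :
    HasSignChanges G f g (univ ×ˢ Ioo hm hp) (c + c') :=
  (hc.union hc' (disjoint_prod.2 (Or.inl (Ioi_disjoint_Iio_same)))).mono
    (union_subset (prod_mono_left (subset_univ _)) (prod_mono_left (subset_univ _)))

theorem HasSignChanges.union_levels {G : ℝ → ℝ} {f g : ℝ[X]} {hm hp hm' hp' : ℝ} {c c' : ℕ}
    (hc : HasSignChanges G f g (univ ×ˢ Ioo hm hp) c)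
    (hc' : HasSignChanges G f g (univ ×ˢ Ioo hm' hp') c') (h₁ : hm ≤ hm') (h : hp ≤ hm')
    (h₂ : hp ≤ hp') :
    HasSignChanges G f g (univ ×ˢ Ioo hm hp') (c + c') :=
  (hc.union hc' (disjoint_prod.2 (Or.inr (Ioo_disjoint_Ioo.2
    ((min_le_left _ _).trans (h.trans (le_max_right _ _))))))).mono
    (union_subset (prod_mono_right (Ioo_subset_Ioo_right h₂))
      (prod_mono_right (Ioo_subset_Ioo_left h₁)))

section
variable {c₁ c₂ : ℝ} {f : ℝ[X]} {k : ℕ} {h : ℕ → ℝ}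

theorem hasSignChanges_inner (h₁ : 0 < c₁) (h₁' : c₁ ≤ 1 / 10) (h₂ : 0 < c₂)
    (h₂' : c₂ ≤ c₁ ^ 2 / 10) (hmono : StrictMono h) (hmem : ∀ j ≤ k, h j ∈ Ioo 0 (c₂ ^ 2 / 2))
    (hr : ∀ j < k, melnikov (fun x => layered c₁ c₂ x ^ 2 / 2) f.eval (√c₁) 3 (h j) *
      melnikov (fun x => layered c₁ c₂ x ^ 2 / 2) f.eval (√c₁) 3 (h (j + 1)) < 0)
    (hl : ∀ j < k, melnikov (fun x => layered c₁ c₂ x ^ 2 / 2) f.eval 0 (√c₁) (h j) *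
      melnikov (fun x => layered c₁ c₂ x ^ 2 / 2) f.eval 0 (√c₁) (h (j + 1)) < 0)
    (hr' : ∀ j < k, melnikov (fun x => layered c₁ c₂ x ^ 2 / 2) f.eval (-3) (-√c₁) (h j) *
      melnikov (fun x => layered c₁ c₂ x ^ 2 / 2) f.eval (-3) (-√c₁) (h (j + 1)) < 0)
    (hl' : ∀ j < k, melnikov (fun x => layered c₁ c₂ x ^ 2 / 2) f.eval (-√c₁) (-0) (h j) *
      melnikov (fun x => layered c₁ c₂ x ^ 2 / 2) f.eval (-√c₁) (-0) (h (j + 1)) < 0) :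
    HasSignChanges (fun x => layered c₁ c₂ x ^ 2 / 2) f (layeredForce c₁ c₂)
      (univ ×ˢ Ioo 0 (c₂ ^ 2 / 2)) (k + k + (k + k)) := by
  have hG : ∀ x, layered c₁ c₂ (-x) ^ 2 / 2 = layered c₁ c₂ x ^ 2 / 2 := fun x => by
    rw [layered_neg]
  have hs : (0 : ℝ) ≤ √c₁ := sqrt_nonneg _
  have Hr := isAnnulus_inner_right h₁ h₁' h₂ h₂'
  have Hl := isAnnulus_inner_left h₁ h₁' h₂ h₂'
  have hd : Disjoint (Ioo (√c₁) 3 ×ˢ Ioo 0 (c₂ ^ 2 / 2)) (Ioo 0 (√c₁) ×ˢ Ioo 0 (c₂ ^ 2 / 2)) :=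
    disjoint_prod.2 (Or.inl (Ioo_disjoint_Ioo.2 ((min_le_right _ _).trans (le_max_left _ _))))
  have hd' : Disjoint (Ioo (-3) (-√c₁) ×ˢ Ioo 0 (c₂ ^ 2 / 2))
      (Ioo (-√c₁) (-0) ×ˢ Ioo 0 (c₂ ^ 2 / 2)) :=
    disjoint_prod.2 (Or.inl (Ioo_disjoint_Ioo.2 ((min_le_left _ _).trans (le_max_right _ _))))
  refine (((Hr.hasSignChanges hmono hmem hr).union (Hl.hasSignChanges hmono hmem hl) hd).mono
    ?_).union_symm ((((Hr.reflect hG (layeredForce_eval_neg c₁ c₂)).hasSignChanges hmono hmem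
    hr').union ((Hl.reflect hG (layeredForce_eval_neg c₁ c₂)).hasSignChanges hmono hmem hl')
    hd').mono ?_)
  · exact union_subset (prod_mono_left fun x hx => hs.trans_lt hx.1)
      (prod_mono_left fun x hx => hx.1)
  · exact union_subset (prod_mono_left fun x hx => hx.2.trans_le (neg_nonpos.2 hs))
      (prod_mono_left fun x hx => hx.2.trans_eq neg_zero)

theorem hasSignChanges_middle (h₁ : 0 < c₁) (h₁' : c₁ ≤ 1 / 10) (h₂ : 0 < c₂)
    (h₂' : c₂ ≤ c₁ ^ 2 / 10) (hmono : StrictMono h)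
    (hmem : ∀ j ≤ k, h j ∈ Ioo ((2 / 5 * c₁ ^ 2) ^ 2) ((1 / 2 * c₁ ^ 2) ^ 2))
    (hr : ∀ j < k, melnikov (fun x => layered c₁ c₂ x ^ 2 / 2) f.eval 0 3 (h j) *
      melnikov (fun x => layered c₁ c₂ x ^ 2 / 2) f.eval 0 3 (h (j + 1)) < 0)
    (hl : ∀ j < k, melnikov (fun x => layered c₁ c₂ x ^ 2 / 2) f.eval (-3) (-0) (h j) *
      melnikov (fun x => layered c₁ c₂ x ^ 2 / 2) f.eval (-3) (-0) (h (j + 1)) < 0) :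
    HasSignChanges (fun x => layered c₁ c₂ x ^ 2 / 2) f (layeredForce c₁ c₂)
      (univ ×ˢ Ioo ((2 / 5 * c₁ ^ 2) ^ 2) ((1 / 2 * c₁ ^ 2) ^ 2)) (k + k) := by
  have hG : ∀ x, layered c₁ c₂ (-x) ^ 2 / 2 = layered c₁ c₂ x ^ 2 / 2 := fun x => by
    rw [layered_neg]
  have H := isAnnulus_middle h₁ h₁' h₂ h₂'
  refine ((H.hasSignChanges hmono hmem hr).mono ?_).union_symm
    (((H.reflect hG (layeredForce_eval_neg c₁ c₂)).hasSignChanges hmono hmem hl).mono ?_)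
  · exact prod_mono_left fun x hx => hx.1
  · exact prod_mono_left fun x hx => hx.2.trans_eq neg_zero

end

/-- The lower bound obtained from three nested layers of annuli. -/
theorem HGe_layered {n k₁ k₂ k₃ : ℕ} (h₁ : 8 * k₁ + 3 ≤ n) (h₂ : 4 * k₂ + 1 ≤ n)
    (h₃ : 2 * k₃ ≤ n) : HGe n 7 (4 * k₁ + 2 * k₂ + k₃ : ℕ) := by
  obtain ⟨q₃, H₃, m₃, hq₃, hmono₃, hmem₃, hm₃, hmel₃⟩ :=
    exists_alternating_melnikov (p := 4) (by norm_num) k₃ one_pos one_lt_two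
  have hev₃ := eventually_outer_sign_changes q₃ hm₃ fun j hj => hmel₃ j (-3) 3 (by norm_num)
    (by norm_num) (by have := (hmem₃ j hj).2; norm_num at this ⊢; linarith)
    (by have := (hmem₃ j hj).2; norm_num at this ⊢; linarith)
  obtain ⟨c₁, hev₃, hc₁, hc₁'⟩ := ((hev₃.filter_mono nhdsWithin_le_nhds).and
    (Ioc_mem_nhdsGT (show (0 : ℝ) < 1 / 10 by norm_num))).exists
  have hc₁2 : 0 < c₁ ^ 2 := pow_pos hc₁ 2
  obtain ⟨q₂, H₂, m₂, hq₂, hmono₂, hmem₂, hm₂, hmel₂⟩ :=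
    exists_alternating_melnikov (p := 2) (by norm_num) k₂
      (show 0 < 2 / 5 * c₁ ^ 2 by linarith) (show 2 / 5 * c₁ ^ 2 < 1 / 2 * c₁ ^ 2 by linarith)
  have hev₂ := eventually_middle_sign_changes q₂ (a := 0 ^ 2 - c₁) (b := 3 ^ 2 - c₁) hm₂
    fun j hj => by
      have := (hmem₂ j hj).2
      have hc4 : 0 < c₁ ^ 4 := pow_pos hc₁ 4
      refine hmel₂ j _ _ (by linarith) (by linarith) (by ring_nf at this ⊢; linarith) ?_
      have : c₁ ^ 4 ≤ (3 ^ 2 - c₁) ^ 4 := pow_le_pow_left₀ hc₁.le (by linarith) 4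
      ring_nf at *
      linarith
  obtain ⟨c₂, ⟨hev₃, hs₂⟩, hc₂, hc₂'⟩ := (((hev₃.and hev₂).filter_mono nhdsWithin_le_nhds).and
    (Ioc_mem_nhdsGT (show (0 : ℝ) < c₁ ^ 2 / 10 by linarith))).exists
  have hc₂2 : 0 < c₂ ^ 2 := pow_pos hc₂ 2
  obtain ⟨q₁, H₁, m₁, hq₁, hmono₁, hmem₁, hm₁, hmel₁⟩ :=
    exists_alternating_melnikov (p := 1) one_ne_zero k₁
      (show 0 < c₂ ^ 2 / 4 by linarith) (show c₂ ^ 2 / 4 < c₂ ^ 2 / 2 by linarith)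
  set G : ℝ → ℝ := fun x => layered c₁ c₂ x ^ 2 / 2 with hG
  have hGd : ∀ x, HasDerivAt G ((layeredForce c₁ c₂).eval x) x := hasDerivAt_layered_potential c₁ c₂
  have hGc : Continuous G := continuous_iff_continuousAt.2 fun x => (hGd x).continuousAt
  set f₁ : ℝ[X] := q₁.comp (((X ^ 2 - C c₁) ^ 2 - C c₂) ^ 2) * (4 * X * (X ^ 2 - C c₁)) with hf₁
  set f₂ : ℝ[X] := q₂.comp ((X ^ 2 - C c₁) ^ 2) * (2 * X) with hf₂
  set f₃ : ℝ[X] := q₃.comp (X ^ 2) with hf₃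
  have M₁ : ∀ a b h, melnikov G f₁.eval a b h = _ := melnikov_layered_inner q₁ c₁ c₂
  have M₂ : ∀ a b h, melnikov G f₂.eval a b h = _ := melnikov_layered_middle q₂ c₁ c₂
  have hV3 := layered_three_le hc₁ hc₁' hc₂'
  have hV0 : layered c₁ c₂ 0 = c₁ ^ 2 - c₂ := by simp [layered]
  have hVs : layered c₁ c₂ (√c₁) = -c₂ := by simp [layered, sq_sqrt hc₁.le]
  have hc₁s : c₁ ^ 2 ≤ 1 / 100 := by nlinarith
  have hinner : ∀ b, c₂ ≤ b → ∀ j ≤ k₁,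
      melnikov (fun v => v ^ (2 * 1) / 2) (fun v => q₁.eval (v ^ 2)) (-c₂) b (H₁ j) = m₁ j := by
    intro b hb j hj
    have := (hmem₁ j hj).2
    rw [pow_one] at this
    have hb2 : c₂ ^ 2 ≤ b ^ 2 := pow_le_pow_left₀ hc₂.le hb 2
    exact hmel₁ j _ _ (by linarith) (by linarith) (by rw [mul_one, neg_sq]; linarith)
      (by rw [mul_one]; linarith)
  have ev : ∀ {a b : ℝ} (σ : ℝ), σ ^ 2 = 1 →
      (∀ j ≤ k₁, melnikov G f₁.eval a b (H₁ j) = σ * m₁ j) →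
      ∀ᶠ ε in 𝓝[>] 0, ∀ j < k₁, melnikov G (f₁ + C ε * f₂ + C (ε ^ 2) * f₃).eval a b (H₁ j) *
        melnikov G (f₁ + C ε * f₂ + C (ε ^ 2) * f₃).eval a b (H₁ (j + 1)) < 0 :=
    fun σ hσ hm => eventually_sign_changes_of_first hGc f₁ f₂ f₃ fun j hj => by
      rw [hm j hj.le, hm _ hj]
      calc σ * m₁ j * (σ * m₁ (j + 1)) = σ ^ 2 * (m₁ j * m₁ (j + 1)) := by ring
        _ < 0 := by rw [hσ, one_mul]; exact hm₁ j hj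
  have hzero : ∀ j ≤ k₂, melnikov (fun v => v ^ (2 * 1) / 2) (fun v => q₁.eval (v ^ 2))
      (layered c₁ c₂ 0) (layered c₁ c₂ 3) (H₂ j) = 0 := by
    intro j hj
    refine melnikov_eq_zero (by rw [hV0]; linarith) fun v hv => ?_
    have h5 : 9 / 10 * c₁ ^ 2 ≤ v := by linarith [hv.1]
    have h6 := pow_le_pow_left₀ (by positivity) h5 2
    have h7 := (hmem₂ j hj).2
    rw [mul_one]
    nlinarith
  have ev1 := ev (a := √c₁) (b := 3) 1 (by norm_num) fun j hj => by
    rw [M₁, hVs, hinner _ (by linarith) j hj, one_mul]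
  have ev2 := ev (a := 0) (b := √c₁) (-1) (by norm_num) fun j hj => by
    rw [M₁, hVs, hV0, melnikov_symm, hinner _ (by linarith) j hj, neg_one_mul]
  have ev3 := ev (a := -3) (b := -√c₁) (-1) (by norm_num) fun j hj => by
    rw [M₁, layered_neg, layered_neg, hVs, melnikov_symm, hinner _ (by linarith) j hj, neg_one_mul]
  have ev4 := ev (a := -√c₁) (b := -0) 1 (by norm_num) fun j hj => by
    rw [M₁, layered_neg, layered_neg, hVs, hV0, hinner _ (by linarith) j hj, one_mul]
  have ev5 := eventually_sign_changes_of_second (a := 0) (b := 3) (h := H₂) (k := k₂) hGc f₂ f₃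
    (fun j hj => by rw [M₁]; exact hzero j hj) fun j hj => by
      rw [M₂, M₂]
      exact hs₂ j hj
  have ev6 := eventually_sign_changes_of_second (a := -3) (b := -0) (h := H₂) (k := k₂) hGc f₂ f₃
    (fun j hj => by
      rw [M₁, layered_neg, layered_neg, melnikov_symm, hzero j hj, neg_zero]) fun j hj => by
      rw [M₂, M₂, neg_sq, neg_sq, melnikov_symm _ _ (0 ^ 2 - c₁) _ (H₂ j),
        melnikov_symm _ _ (0 ^ 2 - c₁) _ (H₂ (j + 1)), neg_mul_neg]
      exact hs₂ j hj
  obtain ⟨ε, ⟨⟨⟨⟨⟨⟨e1, e2⟩, e3⟩, e4⟩, e5⟩, e6⟩, hε⟩⟩ := ((((((ev1.and ev2).and ev3).and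
    ev4).and ev5).and ev6).and self_mem_nhdsWithin).exists
  have e7 := sign_changes_of_third (a := -3) (b := 3) (h := H₃) (k := k₃) hGc f₃
    (fun j _ => by rw [M₁, layered_neg, melnikov_self])
    (fun j _ => by rw [M₂, neg_sq, melnikov_self]) hev₃ (mem_Ioi.1 hε)
  have s1 := hasSignChanges_inner hc₁ hc₁' hc₂ hc₂' hmono₁ (fun j hj =>
    ⟨lt_trans (by rw [pow_one]; linarith) (hmem₁ j hj).1, by simpa using (hmem₁ j hj).2⟩)
    e1 e2 e3 e4
  have s2 := hasSignChanges_middle hc₁ hc₁' hc₂ hc₂' hmono₂ hmem₂ e5 e6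
  have s3 := ((isAnnulus_outer hc₁ hc₁' hc₂ hc₂').hasSignChanges hmono₃
    (fun j hj => by have := hmem₃ j hj; norm_num at this ⊢; exact this) e7).mono
    (prod_mono_left (subset_univ _))
  have hcc : c₂ ^ 2 ≤ (c₁ ^ 2 / 10) ^ 2 := pow_le_pow_left₀ hc₂.le hc₂' 2
  have hc4 : (c₁ ^ 2) ^ 2 ≤ 1 := pow_le_one₀ hc₁2.le (by linarith)
  have hc40 := pow_pos hc₁2 2
  have s12 := s1.union_levels s2 (by positivity) (by nlinarith) (by nlinarith)
  have s123 := s12.union_levels s3 (by norm_num) (by nlinarith) (by nlinarith)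
  rw [show 4 * k₁ + 2 * k₂ + k₃ = k₁ + k₁ + (k₁ + k₁) + (k₂ + k₂) + k₃ by ring]
  refine s123.HGe ?_ (natDegree_layeredForce_le c₁ c₂) hGd
  refine natDegree_add_le_of_degree_le (natDegree_add_le_of_degree_le ?_ ?_) ?_
  · exact (natDegree_inner_le hq₁ c₁ c₂).trans h₁
  · exact (natDegree_C_mul_le _ _).trans ((natDegree_middle_le hq₂ c₁).trans h₂)
  · exact (natDegree_C_mul_le _ _).trans ((natDegree_outer_le hq₃).trans h₃)

theorem stmt4 (n : ℕ) (hn : 7 ≤ n) :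
    HGe n 7 ((3 / 2 : ℝ) * n - 9) := by
  obtain ⟨f, g, hf, hg, ε₀, hε₀, h⟩ := HGe_layered (n := n) (k₁ := (n - 3) / 8)
    (k₂ := (n - 1) / 4) (k₃ := n / 2) (by omega) (by omega) (by omega)
  refine ⟨f, g, hf, hg, ε₀, hε₀, fun ε hε hle => ?_⟩
  obtain ⟨S, hS, hcard⟩ := h ε hε hle
  refine ⟨S, hS, le_trans ?_ hcard⟩
  have h1 : 3 * n ≤ 2 * (4 * ((n - 3) / 8) + 2 * ((n - 1) / 4) + n / 2) + 18 := by omega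
  have h2 : (3 : ℝ) * n ≤ 2 * (4 * ((n - 3) / 8) + 2 * ((n - 1) / 4) + n / 2 : ℕ) + 18 := by
    exact_mod_cast h1
  linarith
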